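/- Let G be a finite abelian group. If G is not cyclic of order p^k or 2p for a prime p and positive integer k (with |G| ≠ 2), and G is not isomorphic to one of the 10 groups C₁₂, C₁₅, C₂₀, C₂₁, C₂×C₄, C₃×C₃, C₄×C₄, C₅×C₅, C₂×C₂×C₃, C₂×C₃×C₃, then α(G) ≤ |G|. Conversely, if G is cyclic of order p^k or 2p (|G| ≠ 2) or isomorphic to one of these 10 groups, then α(G) > |G|. -/

import Mathlib

/-- `graphAlpha G` is the minimum number of vertices of a finite simple graph whose
automorphism group is isomorphic to `G`. -/
noncomputable def graphAlpha (G : Type*) [Group G] : ℕ :=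
  sInf {n : ℕ | ∃ Γ : SimpleGraph (Fin n), Nonempty ((Γ ≃g Γ) ≃* G)}

/-- The cyclic group of order `n`. -/
abbrev Cyc (n : ℕ) := Multiplicative (ZMod n)

/-- `G` is cyclic of order `p ^ k` or `2 * p` for a prime `p` and positive
integer `k`, with `|G| ≠ 2`. -/
def ExcCyclic (G : Type*) [Group G] : Prop :=
  IsCyclic G ∧ Nat.card G ≠ 2 ∧
    ((∃ p k : ℕ, p.Prime ∧ 0 < k ∧ Nat.card G = p ^ k) ∨
      (∃ p : ℕ, p.Prime ∧ Nat.card G = 2 * p))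

/-- The 10 exceptional abelian groups
`C₁₂, C₁₅, C₂₀, C₂₁, C₂×C₄, C₃×C₃, C₄×C₄, C₅×C₅, C₂×C₂×C₃, C₂×C₃×C₃`. -/
def ExcTenAbelian (G : Type*) [Group G] : Prop :=
  Nonempty (G ≃* Cyc 12) ∨ Nonempty (G ≃* Cyc 15) ∨
  Nonempty (G ≃* Cyc 20) ∨ Nonempty (G ≃* Cyc 21) ∨
  Nonempty (G ≃* Multiplicative (ZMod 2 × ZMod 4)) ∨
  Nonempty (G ≃* Multiplicative (ZMod 3 × ZMod 3)) ∨
  Nonempty (G ≃* Multiplicative (ZMod 4 × ZMod 4)) ∨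
  Nonempty (G ≃* Multiplicative (ZMod 5 × ZMod 5)) ∨
  Nonempty (G ≃* Multiplicative (ZMod 2 × ZMod 2 × ZMod 3)) ∨
  Nonempty (G ≃* Multiplicative (ZMod 2 × ZMod 3 × ZMod 3))

/-- The automorphisms of `Γ` are exactly the permutations induced by the faithful action of the
abelian group `G`. -/
structure IsFullAut {V : Type*} (Γ : SimpleGraph V) (G : Type*) [CommGroup G]
    [MulAction G V] : Prop where
  adj_smul : ∀ (g : G) (u v : V), Γ.Adj (g • u) (g • v) ↔ Γ.Adj u v
  exists_smul : ∀ φ : Γ ≃g Γ, ∃ g : G, ∀ v, φ v = g • v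
  eq_one : ∀ g : G, (∀ v : V, g • v = v) → g = 1

section Symmetry

theorem exists_reflection_of_ncard_le_two {Q : Type*} [CommGroup Q] [Finite Q] (T : Set Q)
    (hT : T.ncard ≤ 2) : ∃ c : Q, ∀ q, q ∈ T ↔ c * q⁻¹ ∈ T := by
  have h : T.ncard = 0 ∨ T.ncard = 1 ∨ T.ncard = 2 := by omega
  rcases h with h | h | h
  · rw [Set.ncard_eq_zero] at h
    exact ⟨1, by simp [h]⟩
  · obtain ⟨a, rfl⟩ := Set.ncard_eq_one.1 h
    refine ⟨a * a, fun q => ?_⟩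
    simp only [Set.mem_singleton_iff, mul_inv_eq_iff_eq_mul, mul_right_inj]
    exact eq_comm
  · obtain ⟨a, b, -, rfl⟩ := Set.ncard_eq_two.1 h
    refine ⟨a * b, fun q => ?_⟩
    simp only [Set.mem_insert_iff, Set.mem_singleton_iff, mul_inv_eq_iff_eq_mul, mul_right_inj]
    rw [mul_comm a b, mul_right_inj, eq_comm (a := a), eq_comm (a := b), or_comm]

theorem exists_reflection_of_card_le_five {Q : Type*} [CommGroup Q] [Finite Q] (T : Set Q)
    (hQ : Nat.card Q ≤ 5) : ∃ c : Q, ∀ q, q ∈ T ↔ c * q⁻¹ ∈ T := by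
  by_cases h : T.ncard ≤ 2
  · exact exists_reflection_of_ncard_le_two T h
  · have := Set.ncard_add_ncard_compl T
    obtain ⟨c, hc⟩ := exists_reflection_of_ncard_le_two Tᶜ (by omega)
    exact ⟨c, fun q => not_iff_not.1 (hc q)⟩

theorem exists_reflection_of_relIndex_le_five {G : Type*} [CommGroup G] [Finite G]
    (K N : Subgroup G) (T : Set G) (hT : ∀ k ∈ K, ∀ g, k * g ∈ T ↔ g ∈ T)
    (h : K.relIndex N ≤ 5) : ∃ c ∈ N, ∀ n ∈ N, n ∈ T ↔ c * n⁻¹ ∈ T := by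
  obtain ⟨c, hc⟩ := exists_reflection_of_card_le_five
    {q : N ⧸ K.subgroupOf N | ∃ n : N, (n : N ⧸ K.subgroupOf N) = q ∧ (n : G) ∈ T} h
  have key : ∀ n : N, (n : N ⧸ K.subgroupOf N) ∈
      {q : N ⧸ K.subgroupOf N | ∃ n : N, (n : N ⧸ K.subgroupOf N) = q ∧ (n : G) ∈ T} ↔
        (n : G) ∈ T := by
    intro n
    constructor
    · rintro ⟨m, hm, hmT⟩
      have := QuotientGroup.eq.1 hm
      rw [Subgroup.mem_subgroupOf] at this
      have h2 := (hT _ this m).2 hmT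
      simpa [mul_comm, mul_assoc] using h2
    · intro hn
      exact ⟨n, rfl, hn⟩
  obtain ⟨c, rfl⟩ := QuotientGroup.mk_surjective c
  refine ⟨c, c.2, fun n hn => ?_⟩
  have h1 := hc (⟨n, hn⟩ : N)
  rw [← QuotientGroup.mk_inv, ← QuotientGroup.mk_mul, key, key] at h1
  simpa using h1

end Symmetry

namespace IsFullAut

open MulAction

variable {V : Type*} {Γ : SimpleGraph V} {G : Type*} [CommGroup G] [MulAction G V]

theorem adj_iff_of_mem_sup (h : IsFullAut Γ G) {u v : V} {a : G}
    (ha : a ∈ stabilizer G u ⊔ stabilizer G v) (g : G) :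
    Γ.Adj u (a • g • v) ↔ Γ.Adj u (g • v) := by
  obtain ⟨k, hk, l, hl, rfl⟩ := Subgroup.mem_sup.1 ha
  rw [mem_stabilizer_iff] at hk hl
  have h1 : (k * l) • g • v = k • g • v := by
    conv_rhs => rw [← hl]
    simp only [smul_smul]
    congr 1
    rw [mul_assoc, mul_comm l g]
  rw [h1]
  conv_lhs => rw [← hk]
  exact h.adj_smul k u (g • v)

/-- Twisting the orbits of the points `b i` by an endomorphism `φ` and translations `c i`
gives a graph automorphism, which therefore is the action of a group element. -/
theorem exists_twist [Finite V] (h : IsFullAut Γ G) {ι : Type*} (b : ι → V)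
    (hb : ∀ i j, ∀ g : G, g • b i = b j → i = j) (φ : G →* G)
    (hφ : Function.Surjective φ)
    (hφK : ∀ i, ∀ g ∈ stabilizer G (b i), φ g ∈ stabilizer G (b i)) (c : ι → G)
    (h1 : ∀ i j g, Γ.Adj (b i) (g • b j) ↔ Γ.Adj (c i • b i) (c j • φ g • b j))
    (h2 : ∀ u, (∀ i (g : G), g • b i ≠ u) →
      ∀ i g, Γ.Adj u (g • b i) ↔ Γ.Adj u (c i • φ g • b i)) :
    ∃ a : G, ∀ i (g : G), a • g • b i = c i • φ g • b i := by
  classical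
  let ρ : V → V := fun u =>
    if hu : ∃ p : ι × G, p.2 • b p.1 = u then c hu.choose.1 • φ hu.choose.2 • b hu.choose.1 else u
  have ρ1 : ∀ i g, ρ (g • b i) = c i • φ g • b i := by
    intro i g
    have hu : ∃ p : ι × G, p.2 • b p.1 = g • b i := ⟨(i, g), rfl⟩
    simp only [ρ, dif_pos hu]
    have hs := hu.choose_spec
    set p := hu.choose
    have hi : p.1 = i := by
      apply hb p.1 i (g⁻¹ * p.2)
      rw [mul_smul, hs, inv_smul_smul]
    rw [hi] at hs ⊢
    have hmem : g⁻¹ * p.2 ∈ stabilizer G (b i) := by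
      rw [mem_stabilizer_iff, mul_smul, hs, inv_smul_smul]
    have := hφK i _ hmem
    rw [mem_stabilizer_iff, map_mul, map_inv, mul_smul, inv_smul_eq_iff] at this
    rw [this]
  have ρ2 : ∀ u, (∀ i (g : G), g • b i ≠ u) → ρ u = u := by
    intro u hu
    apply dif_neg
    rintro ⟨p, hp⟩
    exact hu _ _ hp
  have hcase : ∀ u, (∃ i, ∃ g : G, u = g • b i) ∨ (∀ i (g : G), g • b i ≠ u) := by
    intro u
    by_cases hu : ∃ i, ∃ g : G, u = g • b i
    · exact Or.inl hu
    · right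
      intro i g e
      exact hu ⟨i, g, e.symm⟩
  have hsurj : Function.Surjective ρ := by
    intro u
    rcases hcase u with ⟨i, g, rfl⟩ | hu
    · obtain ⟨k, hk⟩ := hφ ((c i)⁻¹ * g)
      refine ⟨k • b i, ?_⟩
      rw [ρ1, hk, smul_smul, mul_inv_cancel_left]
    · exact ⟨u, ρ2 u hu⟩
  have hadj : ∀ u v, Γ.Adj (ρ u) (ρ v) ↔ Γ.Adj u v := by
    intro u v
    rcases hcase u with ⟨i, g, rfl⟩ | hu <;> rcases hcase v with ⟨j, k, rfl⟩ | hv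
    · rw [ρ1, ρ1, ← h.adj_smul g⁻¹ (g • b i), inv_smul_smul, smul_smul g⁻¹ k, h1,
        ← h.adj_smul (φ g)⁻¹]
      simp only [smul_smul, map_mul, map_inv]
      rw [mul_comm (c i), inv_mul_cancel_left]
      have : (φ g)⁻¹ * (c j * φ k) = c j * ((φ g)⁻¹ * φ k) := mul_left_comm _ _ _
      rw [this]
    · rw [ρ1, ρ2 v hv, Γ.adj_comm, Γ.adj_comm _ v]
      exact (h2 v hv i g).symm
    · rw [ρ1, ρ2 u hu]
      exact (h2 u hu j k).symm
    · rw [ρ2 u hu, ρ2 v hv]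
  obtain ⟨a, ha⟩ := h.exists_smul
    ⟨Equiv.ofBijective ρ (Finite.surjective_iff_bijective.1 hsurj), hadj _ _⟩
  refine ⟨a, fun i g => ?_⟩
  rw [← ha]
  exact ρ1 i g

theorem sq_smul_eq_of_reflection [Finite V] (h : IsFullAut Γ G) {ι : Type*} (b : ι → V)
    (hb : ∀ i j, ∀ g : G, g • b i = b j → i = j) (c : ι → G)
    (h1 : ∀ i j, i ≠ j → ∀ g : G, Γ.Adj (b i) (g • b j) ↔ Γ.Adj (c i • b i) (c j • g⁻¹ • b j))
    (h2 : ∀ u, (∀ i (g : G), g • b i ≠ u) →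
      ∀ i (g : G), c i * g ^ 2 ∈ stabilizer G u ⊔ stabilizer G (b i))
    (i : ι) (hi : c i = 1) (g : G) : g ^ 2 • b i = b i := by
  obtain ⟨a, ha⟩ := h.exists_twist b hb invMonoidHom inv_surjective
    (fun i g hg => inv_mem hg) c (fun i j g => by
      rcases eq_or_ne i j with rfl | hij
      · rw [h.adj_smul, invMonoidHom_apply, ← h.adj_smul g⁻¹, inv_smul_smul,
          Γ.adj_comm]
      · exact h1 i j hij g) (fun u hu i g => by
      have := h.adj_iff_of_mem_sup (h2 u hu i g⁻¹) g
      rw [← this, invMonoidHom_apply, smul_smul, smul_smul]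
      have e : c i * g⁻¹ ^ 2 * g = c i * g⁻¹ := by
        rw [mul_assoc, sq, mul_assoc, inv_mul_cancel, mul_one]
      rw [e])
  have ha1 := ha i 1
  have hag := ha i g
  simp only [hi, map_one, one_smul, invMonoidHom_apply] at ha1 hag
  rw [smul_comm, ha1] at hag
  rw [sq, mul_smul, hag, smul_inv_smul]

theorem exists_of_single [Finite V] (h : IsFullAut Γ G) {v : V} {g : G} (hg : g ^ 2 • v ≠ v) :
    ∃ w, w ∉ orbit G v ∧ ∃ g : G, g ^ 2 ∉ stabilizer G v ⊔ stabilizer G w := by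
  by_contra! hcon
  refine hg (h.sq_smul_eq_of_reflection (fun _ : Unit => v) (fun _ _ _ _ => rfl) (fun _ => 1)
    (fun i j hij => (hij rfl).elim) (fun u hu _ g => ?_) () rfl g)
  rw [one_mul, sup_comm]
  exact hcon u (fun ⟨k, hk⟩ => hu () k hk) g

/-- If few connection sets between two orbits are possible, base points can be chosen such
that the connection set is symmetric up to a translation. -/
theorem exists_reflection (h : IsFullAut Γ G) [Finite G] (v w : V)
    (hidx : (stabilizer G v ⊔ stabilizer G w).index ≤ 5) :
    ∃ c : G, ∀ g : G, Γ.Adj v (g • w) ↔ Γ.Adj v (c • g⁻¹ • w) := by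
  obtain ⟨c, -, hc⟩ := exists_reflection_of_relIndex_le_five
    (stabilizer G v ⊔ stabilizer G w) ⊤ {g | Γ.Adj v (g • w)} (fun k hk g => by
      simp only [Set.mem_ofPred_eq, mul_smul]
      exact h.adj_iff_of_mem_sup hk g) (by rwa [Subgroup.relIndex_top_right])
  refine ⟨c, fun g => ?_⟩
  simpa [mul_smul] using hc g trivial

theorem exists_reflection_of_odd (h : IsFullAut Γ G) [Finite G] (v w : V)
    (hidx : (stabilizer G v ⊔ stabilizer G w).index ≤ 5)
    (hodd : Odd (stabilizer G v ⊔ stabilizer G w).index) :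
    ∃ d : G, ∀ g : G, Γ.Adj v (g • d • w) ↔ Γ.Adj v (g⁻¹ • d • w) := by
  obtain ⟨c, hc⟩ := h.exists_reflection v w hidx
  obtain ⟨m, hm⟩ := hodd
  refine ⟨c ^ (m + 1), fun g => ?_⟩
  rw [smul_smul, hc]
  have hmem : c ^ (2 * m + 1) ∈ stabilizer G v ⊔ stabilizer G w := by
    rw [← hm]
    exact Subgroup.pow_index_mem _ c
  rw [smul_smul c, ← h.adj_iff_of_mem_sup hmem (c * (g * c ^ (m + 1))⁻¹)]
  simp only [smul_smul]
  have e : c ^ (2 * m + 1) * c * (g * c ^ (m + 1))⁻¹ = g⁻¹ * c ^ (m + 1) := by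
    rw [mul_inv, ← pow_succ, mul_left_comm]
    congr 1
    rw [mul_inv_eq_iff_eq_mul, ← pow_add]
    congr 1
    ring
  rw [← mul_assoc, e]

theorem exists_of_pair [Finite V] [Finite G] (h : IsFullAut Γ G) {v w : V} (hvw : w ∉ orbit G v)
    {g : G} (hg : g ^ 2 • v ≠ v)
    (hidx : (stabilizer G v ⊔ stabilizer G w).index ≤ 5)
    (hodd : Odd (stabilizer G v ⊔ stabilizer G w).index) :
    ∃ u, u ∉ orbit G v ∧ u ∉ orbit G w ∧
      ((∃ g : G, g ^ 2 ∉ stabilizer G v ⊔ stabilizer G u) ∨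
        ∃ g : G, g ^ 2 ∉ stabilizer G w ⊔ stabilizer G u) := by
  by_contra! hcon
  obtain ⟨d, hd⟩ := h.exists_reflection_of_odd v w hidx hodd
  refine hg (h.sq_smul_eq_of_reflection (fun b : Bool => if b then v else d • w) ?_ (fun _ => 1)
    ?_ ?_ true rfl g)
  · intro i j g hg
    cases i <;> cases j <;> simp only [if_true, if_false, Bool.false_eq_true] at hg ⊢
    · refine (hvw ⟨(g * d)⁻¹, ?_⟩).elim
      simp [← hg, mul_smul]
    · refine (hvw ⟨d⁻¹ * g, ?_⟩).elim
      simp [mul_smul, hg]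
  · intro i j hij g
    cases i <;> cases j <;> simp only [if_true, if_false, Bool.false_eq_true, one_smul] at hij ⊢
    · exact (hij rfl).elim
    · rw [← h.adj_smul g⁻¹, inv_smul_smul, Γ.adj_comm, ← hd, ← h.adj_smul g⁻¹, inv_smul_smul,
        Γ.adj_comm]
    · exact hd g
    · exact (hij rfl).elim
  · intro u hu i g
    have hv : u ∉ orbit G v := fun ⟨k, hk⟩ => hu true k hk
    have hw : u ∉ orbit G w := fun ⟨k, hk⟩ => hu false (k * d⁻¹) (by simpa [mul_smul] using hk)
    have := hcon u hv hw
    rw [one_mul, sup_comm]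
    cases i
    · simpa [stabilizer_smul_eq_right] using this.2 g
    · exact this.1 g

/-- The version of `IsFullAut.exists_of_pair` for an even number of cosets: the remaining
orbits must not interact with the two given ones. -/
theorem exists_of_pair' [Finite V] [Finite G] (h : IsFullAut Γ G) {v w : V} (hvw : w ∉ orbit G v)
    {g : G} (hg : g ^ 2 • v ≠ v)
    (hidx : (stabilizer G v ⊔ stabilizer G w).index ≤ 5) :
    ∃ u, u ∉ orbit G v ∧ u ∉ orbit G w ∧
      (stabilizer G v ⊔ stabilizer G u ≠ ⊤ ∨ stabilizer G w ⊔ stabilizer G u ≠ ⊤) := by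
  by_contra! hcon
  obtain ⟨c, hc⟩ := h.exists_reflection v w hidx
  refine hg (h.sq_smul_eq_of_reflection (fun b : Bool => if b then v else w) ?_
    (fun b => if b then 1 else c) ?_ ?_ true rfl g)
  · intro i j g hg
    cases i <;> cases j <;> simp only [if_true, if_false, Bool.false_eq_true] at hg ⊢
    · exact (hvw ⟨g⁻¹, by simp [← hg]⟩).elim
    · exact (hvw ⟨g, hg⟩).elim
  · intro i j hij g
    cases i <;> cases j <;> simp only [if_true, if_false, Bool.false_eq_true, one_smul] at hij ⊢
    · exact (hij rfl).elim
    · rw [← h.adj_smul g⁻¹, inv_smul_smul, Γ.adj_comm, hc, inv_inv, ← h.adj_smul g⁻¹,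
        smul_comm c g, inv_smul_smul, Γ.adj_comm]
    · exact hc g
    · exact (hij rfl).elim
  · intro u hu i g
    have hv : u ∉ orbit G v := fun ⟨k, hk⟩ => hu true k hk
    have hw : u ∉ orbit G w := fun ⟨k, hk⟩ => hu false k hk
    have := hcon u hv hw
    rw [sup_comm]
    cases i
    · simp [this.2]
    · simp [this.1]

/-- Distinct orbits are disjoint, so their cardinalities add up to at most `|V|`. -/
theorem sum_index_le [Finite V] (l : List V) (hl : l.Pairwise fun u v => v ∉ orbit G u) :
    (l.map fun v => (stabilizer G v).index).sum ≤ Nat.card V := by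
  suffices H : (l.map fun v => (stabilizer G v).index).sum =
      {u : V | ∃ v ∈ l, u ∈ orbit G v}.ncard by
    rw [H]
    exact Set.ncard_le_card _
  induction l with
  | nil => simp
  | cons a l ih =>
    rw [List.pairwise_cons] at hl
    rw [List.map_cons, List.sum_cons, ih hl.2, index_stabilizer, ← Set.ncard_union_eq]
    · congr 1
      ext u
      simp
    · rw [Set.disjoint_left]
      rintro u hu ⟨v, hv, huv⟩
      refine hl.1 v hv ?_
      rw [mem_orbit_symm] at huv
      rw [← orbit_eq_iff] at huv hu ⊢
      rw [huv, hu]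

theorem stabilizer_eq_of_mem_orbit {u v : V} (h : u ∈ orbit G v) :
    stabilizer G u = stabilizer G v := by
  obtain ⟨g, rfl⟩ := h
  exact stabilizer_smul_eq_right g v

theorem notMem_orbit_comm {u v : V} : u ∉ orbit G v ↔ v ∉ orbit G u :=
  not_congr mem_orbit_symm

end IsFullAut

theorem Subgroup.sq_mem_of_gcd_index_dvd_two {G : Type*} [CommGroup G] (H : Subgroup G) {e : ℕ}
    (he : ∀ g : G, g ^ e = 1) (h : e.gcd H.index ∣ 2) (g : G) : g ^ 2 ∈ H := by
  have h1 : orderOf (g : G ⧸ H) ∣ e := orderOf_dvd_of_pow_eq_one (by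
    rw [← QuotientGroup.mk_pow, he]; rfl)
  have h2 : orderOf (g : G ⧸ H) ∣ H.index := _root_.orderOf_dvd_natCard _
  have h3 := orderOf_dvd_iff_pow_eq_one.1 ((Nat.dvd_gcd h1 h2).trans h)
  rwa [← QuotientGroup.mk_pow, QuotientGroup.eq_one_iff] at h3

theorem Subgroup.exists_sq_notMem_of_prime_dvd_index {G : Type*} [CommGroup G] [Finite G]
    (H : Subgroup G) {p : ℕ} (hp : p.Prime) (hp2 : p ≠ 2) (h : p ∣ H.index) :
    ∃ g : G, g ^ 2 ∉ H := by
  by_contra! hcon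
  have := Fact.mk hp
  obtain ⟨q, hq⟩ := exists_prime_orderOf_dvd_card' (G := G ⧸ H) p h
  obtain ⟨g, rfl⟩ := QuotientGroup.mk_surjective q
  have h1 : (g : G ⧸ H) ^ 2 = 1 := by
    rw [← QuotientGroup.mk_pow, QuotientGroup.eq_one_iff]
    exact hcon g
  have := orderOf_dvd_of_pow_eq_one h1
  rw [hq, Nat.prime_dvd_prime_iff_eq hp Nat.prime_two] at this
  exact hp2 this

theorem Subgroup.exists_sq_notMem_of_isCyclic {G : Type*} [CommGroup G] [IsCyclic G]
    (H : Subgroup G) (h : ¬ H.index ∣ 2) : ∃ g : G, g ^ 2 ∉ H := by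
  by_contra! hcon
  have := isCyclic_of_surjective (QuotientGroup.mk' H) (QuotientGroup.mk'_surjective H)
  obtain ⟨g, hg⟩ := IsCyclic.exists_generator (α := G ⧸ H)
  obtain ⟨g, rfl⟩ := QuotientGroup.mk_surjective g
  have h1 : (g : G ⧸ H) ^ 2 = 1 := by
    rw [← QuotientGroup.mk_pow, QuotientGroup.eq_one_iff]
    exact hcon g
  have := orderOf_dvd_of_pow_eq_one h1
  rw [orderOf_eq_card_of_forall_mem_zpowers hg] at this
  exact h this

namespace IsFullAut

open MulAction

variable {V : Type*} {Γ : SimpleGraph V} {G : Type*} [CommGroup G] [MulAction G V]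

theorem notMem_orbit_of_index_ne {u v : V}
    (h : (stabilizer G u).index ≠ (stabilizer G v).index) : u ∉ orbit G v :=
  fun hu => h (by rw [stabilizer_eq_of_mem_orbit hu])

theorem index_sup_dvd_gcd (u v : V) : (stabilizer G u ⊔ stabilizer G v).index ∣
    (stabilizer G u).index.gcd (stabilizer G v).index :=
  Nat.dvd_gcd (Subgroup.index_dvd_of_le le_sup_left) (Subgroup.index_dvd_of_le le_sup_right)

theorem sq_mem_sup_of_gcd_dvd_two {u v : V}
    (h : (stabilizer G u).index.gcd (stabilizer G v).index ∣ 2) (g : G) :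
    g ^ 2 ∈ stabilizer G u ⊔ stabilizer G v :=
  Subgroup.sq_mem_of_gcd_index_dvd_two _ (e := 0) (fun g => pow_zero g)
    (by rw [Nat.gcd_zero_left]; exact (index_sup_dvd_gcd u v).trans h) g

theorem exists_of_single_of_isCyclic [Finite V] [IsCyclic G] (h : IsFullAut Γ G) {v : V}
    (hv : ¬ (stabilizer G v).index ∣ 2) :
    ∃ w, w ∉ orbit G v ∧ ¬ (stabilizer G v).index.gcd (stabilizer G w).index ∣ 2 := by
  obtain ⟨g, hg⟩ := Subgroup.exists_sq_notMem_of_isCyclic _ hv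
  obtain ⟨w, hw, g', hg'⟩ := h.exists_of_single hg
  exact ⟨w, hw, fun hd => hg' (sq_mem_sup_of_gcd_dvd_two hd g')⟩

theorem exists_of_pair_of_isCyclic [Finite V] [Finite G] [IsCyclic G] (h : IsFullAut Γ G)
    {v w : V} {p : ℕ} (hp : p = 3 ∨ p = 5) (hvw : w ∉ orbit G v)
    (hv : (stabilizer G v).index = p) (hw : (stabilizer G w).index = p) :
    ∃ u, u ∉ orbit G v ∧ u ∉ orbit G w ∧ ¬ p.gcd (stabilizer G u).index ∣ 2 := by
  obtain ⟨g, hg⟩ := Subgroup.exists_sq_notMem_of_isCyclic (stabilizer G v)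
    (by rw [hv]; rcases hp with rfl | rfl <;> decide)
  have hidx : (stabilizer G v ⊔ stabilizer G w).index ∣ p := by
    have := index_sup_dvd_gcd (G := G) v w
    rwa [hv, hw, Nat.gcd_self] at this
  obtain ⟨u, hu1, hu2, hu⟩ := h.exists_of_pair hvw hg
    ((Nat.le_of_dvd (by omega) hidx).trans (by omega))
    (Odd.of_dvd_nat (by rcases hp with rfl | rfl <;> decide) hidx)
  refine ⟨u, hu1, hu2, fun hd => ?_⟩
  rcases hu with ⟨g', hg'⟩ | ⟨g', hg'⟩
  · exact hg' (sq_mem_sup_of_gcd_dvd_two (by rwa [hv]) g')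
  · exact hg' (sq_mem_sup_of_gcd_dvd_two (by rwa [hw]) g')

theorem exists_not_dvd_card_of_isCyclic [Finite G] [IsCyclic G] (h : IsFullAut Γ G) {p : ℕ}
    (hp : p.Prime) (hpG : p ∣ Nat.card G) : ∃ v : V, ¬ p ∣ Nat.card (stabilizer G v) := by
  classical
  have := Fact.mk hp
  have := Fintype.ofFinite G
  by_contra! hcon
  obtain ⟨z, hz⟩ := exists_prime_orderOf_dvd_card' (G := G) p hpG
  have hz1 : z ≠ 1 := by
    rintro rfl
    rw [orderOf_one] at hz
    exact hp.one_lt.ne hz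
  refine hz1 (h.eq_one z fun v => ?_)
  obtain ⟨y, hy⟩ := exists_prime_orderOf_dvd_card' (G := stabilizer G v) p (hcon v)
  have hy' : orderOf (y : G) = p := by rw [Subgroup.orderOf_coe, hy]
  have hcard : Nat.card (Subgroup.zpowers (y : G)) = Nat.card (Subgroup.zpowers z) := by
    rw [Nat.card_zpowers, Nat.card_zpowers, hy', hz]
  have hle : Subgroup.zpowers z ≤ Subgroup.zpowers (y : G) := by
    have hsub : ∀ a : G, orderOf a = p → (Subgroup.zpowers a : Set G) =
        ((Finset.univ.filter fun x : G => x ^ p = 1 : Finset G) : Set G) := by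
      intro a ha
      rw [← Set.coe_toFinset (Subgroup.zpowers a : Set G), Finset.coe_inj]
      apply Finset.eq_of_subset_of_card_le
      · intro x hx
        rw [Set.mem_toFinset] at hx
        obtain ⟨k, rfl⟩ := hx
        rw [Finset.mem_filter]
        refine ⟨Finset.mem_univ _, ?_⟩
        simp only
        rw [← zpow_natCast, zpow_comm, zpow_natCast, ← ha, pow_orderOf_eq_one, one_zpow]
      · refine (IsCyclic.card_pow_eq_one_le hp.pos).trans ?_
        rw [Set.toFinset_card, ← Nat.card_eq_fintype_card]
        exact (Nat.card_zpowers a).symm ▸ ha.ge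
    intro x hx
    rw [← SetLike.mem_coe, hsub _ hy', ← hsub _ hz]
    exact hx
  have := hle (Subgroup.mem_zpowers z)
  have hle2 : Subgroup.zpowers (y : G) ≤ stabilizer G v := by
    rw [Subgroup.zpowers_le]
    exact y.2
  exact hle2 this

theorem lt_card_of_isCyclic_prime_pow [Finite V] [Finite G] [IsCyclic G] (h : IsFullAut Γ G)
    {p k : ℕ} (hp : p.Prime) (hk : 0 < k) (hG : Nat.card G = p ^ k) (h2 : Nat.card G ≠ 2) :
    Nat.card G < Nat.card V := by
  obtain ⟨v, hv⟩ := h.exists_not_dvd_card_of_isCyclic hp (hG ▸ dvd_pow_self p hk.ne')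
  have hm := (stabilizer G v).card_mul_index
  have h1 : Nat.card (stabilizer G v) = 1 := by
    obtain ⟨i, -, hi⟩ := (Nat.dvd_prime_pow hp).1 (hG ▸ Dvd.intro _ hm)
    rcases Nat.eq_zero_or_pos i with rfl | hi0
    · simpa using hi
    · exact (hv (hi ▸ dvd_pow_self p hi0.ne')).elim
  rw [h1, one_mul] at hm
  have hcard : 2 < Nat.card G := by
    have := hp.two_le.trans (Nat.le_self_pow hk.ne' p)
    omega
  obtain ⟨w, hw, -⟩ := h.exists_of_single_of_isCyclic (v := v) (fun hd => by
    have := Nat.le_of_dvd two_pos hd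
    omega)
  have hs := sum_index_le (G := G) [v, w] (by simpa using hw)
  have hw0 := (stabilizer G w).index_ne_zero_of_finite
  simp at hs
  omega

theorem lt_card_of_isCyclic_two_mul_prime [Finite V] [Finite G] [IsCyclic G]
    (h : IsFullAut Γ G) {p : ℕ} (hp : p.Prime) (hp2 : p ≠ 2) (hG : Nat.card G = 2 * p) :
    Nat.card G < Nat.card V := by
  obtain ⟨v, hv⟩ := h.exists_not_dvd_card_of_isCyclic hp (hG ▸ dvd_mul_left p 2)
  obtain ⟨u, hu⟩ := h.exists_not_dvd_card_of_isCyclic Nat.prime_two (hG ▸ dvd_mul_right 2 p)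
  have hmv := (stabilizer G v).card_mul_index
  have hmu := (stabilizer G u).card_mul_index
  have hp3 : 3 ≤ p := by have := hp.two_le; omega
  have hpv : p ∣ (stabilizer G v).index :=
    (hp.dvd_mul.1 (hmv ▸ hG ▸ dvd_mul_left p 2)).resolve_left hv
  have h2u : 2 ∣ (stabilizer G u).index :=
    (Nat.prime_two.dvd_mul.1 (hmu ▸ hG ▸ dvd_mul_right 2 p)).resolve_left hu
  have hv0 := (stabilizer G v).index_ne_zero_of_finite
  have hu0 := (stabilizer G u).index_ne_zero_of_finite
  obtain ⟨w, hw, hwg⟩ := h.exists_of_single_of_isCyclic (v := v) (fun hd => by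
    have := Nat.le_of_dvd two_pos (hpv.trans hd)
    omega)
  have hw0 := (stabilizer G w).index_ne_zero_of_finite
  have hpodd : ¬ 2 ∣ p := fun hd => hp2 ((Nat.prime_dvd_prime_iff_eq Nat.prime_two hp).1 hd).symm
  have hs := sum_index_le (G := G) [v, w] (by simpa using hw)
  simp at hs
  by_contra hlt
  obtain ⟨a, ha⟩ := hpv
  have ha1 : a = 1 := by
    have ha0 : a ≠ 0 := by rintro rfl; exact hv0 ha
    by_contra hne
    have : p * 2 ≤ p * a := Nat.mul_le_mul_left p (by omega)
    omega
  rw [ha1, mul_one] at ha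
  have hpw : p ∣ (stabilizer G w).index := by
    by_contra hnd
    rw [ha, (Nat.Prime.coprime_iff_not_dvd hp).2 hnd] at hwg
    exact hwg (one_dvd _)
  obtain ⟨b, hb⟩ := hpw
  have hb1 : b = 1 := by
    have hb0 : b ≠ 0 := by rintro rfl; exact hw0 hb
    by_contra hne
    have : p * 2 ≤ p * b := Nat.mul_le_mul_left p (by omega)
    omega
  rw [hb1, mul_one] at hb
  have hs := sum_index_le (G := G) [v, w, u] (by
    simp only [List.pairwise_cons, List.mem_cons, List.not_mem_nil, or_false, forall_eq_or_imp,
      forall_eq, IsEmpty.forall_iff, implies_true, List.Pairwise.nil, and_true]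
    refine ⟨⟨hw, notMem_orbit_of_index_ne ?_⟩, notMem_orbit_of_index_ne ?_⟩ <;> intro e <;>
      rw [e] at h2u <;> omega)
  simp at hs
  omega

end IsFullAut

theorem Nat.Prime.dvd_of_not_gcd_dvd_two {p n : ℕ} (hp : p.Prime) (h : ¬ p.gcd n ∣ 2) : p ∣ n := by
  by_contra hn
  rw [(Nat.Prime.coprime_iff_not_dvd hp).2 hn] at h
  exact h (one_dvd _)

theorem Nat.four_dvd_of_not_gcd_dvd_two {n : ℕ} (h : ¬ Nat.gcd 4 n ∣ 2) : 4 ∣ n := by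
  have h1 : Nat.gcd 4 n ∣ 2 ^ 2 := Nat.gcd_dvd_left 4 n
  obtain ⟨i, hi, e⟩ := (Nat.dvd_prime_pow Nat.prime_two).1 h1
  rw [e] at h
  interval_cases i <;> simp at h
  have := Nat.gcd_dvd_right 4 n
  rwa [e] at this

namespace IsFullAut

open MulAction

variable {V : Type*} {Γ : SimpleGraph V} {G : Type*} [CommGroup G] [MulAction G V]

theorem lt_card_of_isCyclic_twelve [Finite V] [Finite G] [IsCyclic G] (h : IsFullAut Γ G)
    (hG : Nat.card G = 12) : 12 < Nat.card V := by
  obtain ⟨v, hv⟩ := h.exists_not_dvd_card_of_isCyclic Nat.prime_two (hG ▸ by norm_num)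
  obtain ⟨u, hu⟩ := h.exists_not_dvd_card_of_isCyclic Nat.prime_three (hG ▸ by norm_num)
  have h4 : ∀ a b : ℕ, a * b = 12 → ¬ 2 ∣ a → b = 4 ∨ b = 12 := fun a b hab ha => by
    have : a ≤ 12 := Nat.le_of_dvd (by norm_num) (Dvd.intro _ hab)
    interval_cases a <;> omega
  have h3 : ∀ a b : ℕ, a * b = 12 → ¬ 3 ∣ a → b = 3 ∨ b = 6 ∨ b = 12 := fun a b hab ha => by
    have : a ≤ 12 := Nat.le_of_dvd (by norm_num) (Dvd.intro _ hab)
    interval_cases a <;> omega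
  have iv := h4 _ _ ((stabilizer G v).card_mul_index.trans hG) hv
  have iu := h3 _ _ ((stabilizer G u).card_mul_index.trans hG) hu
  by_contra hlt
  obtain ⟨w, hw, hwg⟩ := h.exists_of_single_of_isCyclic (v := v) (by
    rcases iv with e | e <;> rw [e] <;> decide)
  have hw0 := (stabilizer G w).index_ne_zero_of_finite
  have hs := sum_index_le (G := G) [v, w] (by simpa using hw)
  simp at hs
  have iv : (stabilizer G v).index = 4 := by omega
  rw [iv] at hwg
  have iw := Nat.four_dvd_of_not_gcd_dvd_two hwg
  obtain ⟨x, hx, hxg⟩ := h.exists_of_single_of_isCyclic (v := u) (by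
    rcases iu with e | e | e <;> rw [e] <;> decide)
  have hx0 := (stabilizer G x).index_ne_zero_of_finite
  have huv : u ∉ orbit G v := notMem_orbit_of_index_ne (by omega)
  have hs := sum_index_le (G := G) [u, x] (by simpa using hx)
  simp at hs
  have huw : u ∉ orbit G w := notMem_orbit_of_index_ne (by omega)
  have hs := sum_index_le (G := G) [v, w, u] (by simp [hw, huv, huw])
  simp at hs
  have iu : (stabilizer G u).index = 3 := by omega
  rw [iu] at hxg
  have ix := Nat.prime_three.dvd_of_not_gcd_dvd_two hxg
  have hxv : x ∉ orbit G v := notMem_orbit_of_index_ne (by omega)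
  have hxw : x ∉ orbit G w := notMem_orbit_of_index_ne (by omega)
  have hs := sum_index_le (G := G) [v, w, u, x] (by simp [hw, huv, huw, hxv, hxw, hx])
  simp at hs
  omega

theorem lt_card_of_isCyclic_fifteen [Finite V] [Finite G] [IsCyclic G] (h : IsFullAut Γ G)
    (hG : Nat.card G = 15) : 15 < Nat.card V := by
  obtain ⟨v, hv⟩ := h.exists_not_dvd_card_of_isCyclic Nat.prime_five (hG ▸ by norm_num)
  obtain ⟨u, hu⟩ := h.exists_not_dvd_card_of_isCyclic Nat.prime_three (hG ▸ by norm_num)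
  have h5 : ∀ a b : ℕ, a * b = 15 → ¬ 5 ∣ a → b = 5 ∨ b = 15 := fun a b hab ha => by
    have : a ≤ 15 := Nat.le_of_dvd (by norm_num) (Dvd.intro _ hab)
    interval_cases a <;> omega
  have h3 : ∀ a b : ℕ, a * b = 15 → ¬ 3 ∣ a → b = 3 ∨ b = 15 := fun a b hab ha => by
    have : a ≤ 15 := Nat.le_of_dvd (by norm_num) (Dvd.intro _ hab)
    interval_cases a <;> omega
  have iv := h5 _ _ ((stabilizer G v).card_mul_index.trans hG) hv
  have iu := h3 _ _ ((stabilizer G u).card_mul_index.trans hG) hu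
  by_contra hlt
  obtain ⟨w, hw, hwg⟩ := h.exists_of_single_of_isCyclic (v := v) (by
    rcases iv with e | e <;> rw [e] <;> decide)
  have hw0 := (stabilizer G w).index_ne_zero_of_finite
  have hs := sum_index_le (G := G) [v, w] (by simpa using hw)
  simp at hs
  have iv : (stabilizer G v).index = 5 := by omega
  rw [iv] at hwg
  have iw := Nat.prime_five.dvd_of_not_gcd_dvd_two hwg
  obtain ⟨x, hx, hxg⟩ := h.exists_of_single_of_isCyclic (v := u) (by
    rcases iu with e | e <;> rw [e] <;> decide)
  have hx0 := (stabilizer G x).index_ne_zero_of_finite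
  have huv : u ∉ orbit G v := notMem_orbit_of_index_ne (by omega)
  have hs := sum_index_le (G := G) [u, x] (by simpa using hx)
  simp at hs
  have huw : u ∉ orbit G w := notMem_orbit_of_index_ne (by omega)
  have hs := sum_index_le (G := G) [v, w, u] (by simp [hw, huv, huw])
  simp at hs
  have iu : (stabilizer G u).index = 3 := by omega
  rw [iu] at hxg
  have ix := Nat.prime_three.dvd_of_not_gcd_dvd_two hxg
  have hxv : x ∉ orbit G v := notMem_orbit_of_index_ne (by omega)
  have iw5 : (stabilizer G w).index = 5 := by omega
  by_cases hxw : x ∈ orbit G w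
  · rw [stabilizer_eq_of_mem_orbit hxw] at ix
    omega
  have hs := sum_index_le (G := G) [v, w, u, x] (by simp [hw, huv, huw, hxv, hxw, hx])
  simp at hs
  omega

theorem lt_card_of_isCyclic_twenty [Finite V] [Finite G] [IsCyclic G] (h : IsFullAut Γ G)
    (hG : Nat.card G = 20) : 20 < Nat.card V := by
  obtain ⟨v, hv⟩ := h.exists_not_dvd_card_of_isCyclic Nat.prime_two (hG ▸ by norm_num)
  obtain ⟨u, hu⟩ := h.exists_not_dvd_card_of_isCyclic Nat.prime_five (hG ▸ by norm_num)
  have h4 : ∀ a b : ℕ, a * b = 20 → ¬ 2 ∣ a → b = 4 ∨ b = 20 := fun a b hab ha => by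
    have : a ≤ 20 := Nat.le_of_dvd (by norm_num) (Dvd.intro _ hab)
    interval_cases a <;> omega
  have h5 : ∀ a b : ℕ, a * b = 20 → ¬ 5 ∣ a → b = 5 ∨ b = 10 ∨ b = 20 := fun a b hab ha => by
    have : a ≤ 20 := Nat.le_of_dvd (by norm_num) (Dvd.intro _ hab)
    interval_cases a <;> omega
  have iv := h4 _ _ ((stabilizer G v).card_mul_index.trans hG) hv
  have iu := h5 _ _ ((stabilizer G u).card_mul_index.trans hG) hu
  by_contra hlt
  obtain ⟨w, hw, hwg⟩ := h.exists_of_single_of_isCyclic (v := v) (by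
    rcases iv with e | e <;> rw [e] <;> decide)
  have hw0 := (stabilizer G w).index_ne_zero_of_finite
  have hs := sum_index_le (G := G) [v, w] (by simpa using hw)
  simp at hs
  have iv : (stabilizer G v).index = 4 := by omega
  rw [iv] at hwg
  have iw := Nat.four_dvd_of_not_gcd_dvd_two hwg
  obtain ⟨x, hx, hxg⟩ := h.exists_of_single_of_isCyclic (v := u) (by
    rcases iu with e | e | e <;> rw [e] <;> decide)
  have hx0 := (stabilizer G x).index_ne_zero_of_finite
  have huv : u ∉ orbit G v := notMem_orbit_of_index_ne (by omega)
  have hs := sum_index_le (G := G) [u, x] (by simpa using hx)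
  simp at hs
  have huw : u ∉ orbit G w := notMem_orbit_of_index_ne (by omega)
  have hs := sum_index_le (G := G) [v, w, u] (by simp [hw, huv, huw])
  simp at hs
  have h5x : 5 ∣ (stabilizer G x).index := by
    rcases iu with e | e | e
    · rw [e] at hxg
      exact Nat.prime_five.dvd_of_not_gcd_dvd_two hxg
    · by_contra hnd
      rw [e, show 10 = 2 * 5 from rfl, Nat.Coprime.gcd_mul_right_cancel 2
        ((Nat.Prime.coprime_iff_not_dvd Nat.prime_five).2 hnd)] at hxg
      exact hxg (Nat.gcd_dvd_left _ _)
    · omega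
  have hxv : x ∉ orbit G v := notMem_orbit_of_index_ne (by omega)
  have hxw : x ∉ orbit G w := notMem_orbit_of_index_ne (by omega)
  have hs := sum_index_le (G := G) [v, w, u, x] (by simp [hw, huv, huw, hxv, hxw, hx])
  simp at hs
  obtain ⟨y, hyu, hyx, hy⟩ := h.exists_of_pair_of_isCyclic (p := 5) (Or.inr rfl) hx
    (by omega) (by omega)
  have iy := Nat.prime_five.dvd_of_not_gcd_dvd_two hy
  have hy0 := (stabilizer G y).index_ne_zero_of_finite
  have hyv : y ∉ orbit G v := notMem_orbit_of_index_ne (by omega)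
  have hyw : y ∉ orbit G w := notMem_orbit_of_index_ne (by omega)
  have hs := sum_index_le (G := G) [v, w, u, x, y]
    (by simp [hw, huv, huw, hxv, hxw, hx, hyv, hyw, hyu, hyx])
  simp at hs
  omega

theorem lt_card_of_isCyclic_twentyOne [Finite V] [Finite G] [IsCyclic G] (h : IsFullAut Γ G)
    (hG : Nat.card G = 21) : 21 < Nat.card V := by
  have h7' : Nat.Prime 7 := by norm_num
  obtain ⟨v, hv⟩ := h.exists_not_dvd_card_of_isCyclic h7' (hG ▸ by norm_num)
  obtain ⟨u, hu⟩ := h.exists_not_dvd_card_of_isCyclic Nat.prime_three (hG ▸ by norm_num)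
  have h7 : ∀ a b : ℕ, a * b = 21 → ¬ 7 ∣ a → b = 7 ∨ b = 21 := fun a b hab ha => by
    have : a ≤ 21 := Nat.le_of_dvd (by norm_num) (Dvd.intro _ hab)
    interval_cases a <;> omega
  have h3 : ∀ a b : ℕ, a * b = 21 → ¬ 3 ∣ a → b = 3 ∨ b = 21 := fun a b hab ha => by
    have : a ≤ 21 := Nat.le_of_dvd (by norm_num) (Dvd.intro _ hab)
    interval_cases a <;> omega
  have h37 : ∀ y : V, ¬ (7 ∣ (stabilizer G y).index ∧ 3 ∣ (stabilizer G y).index ∧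
      (stabilizer G y).index ≤ 20) := by
    rintro y ⟨h7, h3, h20⟩
    have := (stabilizer G y).index_ne_zero_of_finite
    omega
  have iv := h7 _ _ ((stabilizer G v).card_mul_index.trans hG) hv
  have iu := h3 _ _ ((stabilizer G u).card_mul_index.trans hG) hu
  by_contra hlt
  obtain ⟨w, hw, hwg⟩ := h.exists_of_single_of_isCyclic (v := v) (by
    rcases iv with e | e <;> rw [e] <;> decide)
  have hw0 := (stabilizer G w).index_ne_zero_of_finite
  have hs := sum_index_le (G := G) [v, w] (by simpa using hw)
  simp at hs
  have iv : (stabilizer G v).index = 7 := by omega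
  rw [iv] at hwg
  have iw := h7'.dvd_of_not_gcd_dvd_two hwg
  obtain ⟨x, hx, hxg⟩ := h.exists_of_single_of_isCyclic (v := u) (by
    rcases iu with e | e <;> rw [e] <;> decide)
  have hx0 := (stabilizer G x).index_ne_zero_of_finite
  have huv : u ∉ orbit G v := notMem_orbit_of_index_ne (by omega)
  have hs := sum_index_le (G := G) [u, x] (by simpa using hx)
  simp at hs
  have huw : u ∉ orbit G w := notMem_orbit_of_index_ne (by omega)
  have hs := sum_index_le (G := G) [v, w, u] (by simp [hw, huv, huw])
  simp at hs
  have iu : (stabilizer G u).index = 3 := by omega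
  rw [iu] at hxg
  have ix := Nat.prime_three.dvd_of_not_gcd_dvd_two hxg
  have hxv : x ∉ orbit G v := notMem_orbit_of_index_ne (by omega)
  have hxw : x ∉ orbit G w := notMem_orbit_of_index_ne fun e => h37 x ⟨e ▸ iw, ix, by omega⟩
  have hs := sum_index_le (G := G) [v, w, u, x] (by simp [hw, huv, huw, hxv, hxw, hx])
  simp at hs
  obtain ⟨y, hyu, hyx, hy⟩ := h.exists_of_pair_of_isCyclic (p := 3) (Or.inl rfl) hx
    (by omega) (by omega)
  have iy := Nat.prime_three.dvd_of_not_gcd_dvd_two hy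
  have hy0 := (stabilizer G y).index_ne_zero_of_finite
  have hyv : y ∉ orbit G v := notMem_orbit_of_index_ne (by omega)
  have hyw : y ∉ orbit G w := notMem_orbit_of_index_ne (by omega)
  have hs := sum_index_le (G := G) [v, w, u, x, y]
    (by simp [hw, huv, huw, hxv, hxw, hx, hyv, hyw, hyu, hyx])
  simp at hs
  omega

/-- No graph with abelian automorphism group of order `p ^ 2` and at most `p ^ 2` vertices
exists for `p = 3, 5`. -/
theorem lt_card_of_card_eq_prime_sq [Finite V] [Finite G] (h : IsFullAut Γ G) {p : ℕ}
    (hp : p = 3 ∨ p = 5) (hG : Nat.card G = p ^ 2) : Nat.card G < Nat.card V := by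
  have hpp : p.Prime := by rcases hp with rfl | rfl <;> norm_num
  have hp2 : p ≠ 2 := by omega
  have hdvd : ∀ K : Subgroup G, K.index = 1 ∨ K.index = p ∨ K.index = p ^ 2 := by
    intro K
    obtain ⟨i, hi, e⟩ := (Nat.dvd_prime_pow hpp).1 (hG ▸ K.index_dvd_card)
    interval_cases i <;> simp [e]
  have hsq : ∀ K : Subgroup G, K ≠ ⊤ → ∃ g : G, g ^ 2 ∉ K := by
    intro K hK
    refine K.exists_sq_notMem_of_prime_dvd_index hpp hp2 ?_
    rw [Ne, ← Subgroup.index_eq_one] at hK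
    rcases hdvd K with e | e | e
    · exact (hK e).elim
    · rw [e]
    · exact e ▸ dvd_pow_self p two_ne_zero
  by_contra! hlt
  have hne : ∀ v : V, (stabilizer G v) ≠ ⊤ → (stabilizer G v).index = p := by
    intro v hv
    rcases hdvd (stabilizer G v) with e | e | e
    · exact (hv (Subgroup.index_eq_one.1 e)).elim
    · exact e
    · obtain ⟨g, hg⟩ := hsq _ hv
      obtain ⟨w, hw, -⟩ := h.exists_of_single hg
      have hs := sum_index_le (G := G) [v, w] (by simpa using hw)
      have hw0 := (stabilizer G w).index_ne_zero_of_finite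
      simp at hs
      omega
  have hmax : ∀ (v : V) (K : Subgroup G), stabilizer G v ≠ ⊤ → (∃ g : G, g ^ 2 ∉ K) →
      stabilizer G v ≤ K → K = stabilizer G v := by
    rintro v K hv ⟨g, hg⟩ hle
    have hi := hne v hv
    have hd := Subgroup.index_dvd_of_le hle
    rw [hi] at hd
    rcases (Nat.dvd_prime hpp).1 hd with e | e
    · rw [Subgroup.index_eq_one] at e
      exact (hg (e ▸ trivial)).elim
    · refine (Subgroup.eq_of_le_of_card_ge hle ?_).symm
      have h1 := K.card_mul_index
      have h2 := (stabilizer G v).card_mul_index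
      rw [e, ← h2, hi] at h1
      exact (Nat.eq_of_mul_eq_mul_right hpp.pos h1).le
  have hsup : ∀ v w : V, stabilizer G v ≠ ⊤ → stabilizer G w ≠ ⊤ →
      (∃ g : G, g ^ 2 ∉ stabilizer G v ⊔ stabilizer G w) → stabilizer G w = stabilizer G v :=
    fun v w hv hw hg =>
      (hmax w _ hw hg le_sup_right).symm.trans (hmax v _ hv hg le_sup_left)
  have hntop : ∀ v w : V, (∃ g : G, g ^ 2 ∉ stabilizer G v ⊔ stabilizer G w) →
      stabilizer G w ≠ ⊤ := by
    rintro v w ⟨g, hg⟩ e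
    rw [e, sup_top_eq] at hg
    exact hg trivial
  have hpair : ∀ v : V, stabilizer G v ≠ ⊤ →
      ∃ w, w ∉ orbit G v ∧ stabilizer G w = stabilizer G v := by
    intro v hv
    obtain ⟨g, hg⟩ := hsq _ hv
    obtain ⟨w, hw, hwg⟩ := h.exists_of_single hg
    exact ⟨w, hw, hsup v w hv (hntop v w hwg) hwg⟩
  have htriple : ∀ v w : V, stabilizer G v ≠ ⊤ → w ∉ orbit G v →
      stabilizer G w = stabilizer G v →
      ∃ u, u ∉ orbit G v ∧ u ∉ orbit G w ∧ stabilizer G u = stabilizer G v := by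
    intro v w hv hw e
    obtain ⟨g, hg⟩ := hsq _ hv
    have hi : (stabilizer G v ⊔ stabilizer G w).index = p := by rw [e, sup_idem, hne v hv]
    obtain ⟨u, hu1, hu2, hu⟩ := h.exists_of_pair hw hg (by rw [hi]; omega)
      (by rw [hi]; rcases hp with rfl | rfl <;> decide)
    rw [e, or_self] at hu
    exact ⟨u, hu1, hu2, hsup v u hv (hntop v u hu) hu⟩
  have hex : ∀ K : Subgroup G, K ≠ ⊥ → ∃ v : V, ¬ K ≤ stabilizer G v := by
    intro K hK
    by_contra! hcon
    refine hK (eq_bot_iff.2 fun g hg => ?_)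
    exact h.eq_one g fun v => hcon v hg
  have hbot : (⊤ : Subgroup G) ≠ ⊥ := by
    intro e
    have h1 := Subgroup.card_top (G := G)
    rw [e, Subgroup.card_bot, hG] at h1
    rcases hp with rfl | rfl <;> omega
  obtain ⟨v, hv⟩ := hex ⊤ hbot
  rw [top_le_iff] at hv
  have hvbot : stabilizer G v ≠ ⊥ := by
    intro e
    have h1 := hne v hv
    rw [e, Subgroup.index_bot, hG] at h1
    rcases hp with rfl | rfl <;> omega
  obtain ⟨w, hw⟩ := hex _ hvbot
  have hw1 : stabilizer G w ≠ ⊤ := fun e => hw (e ▸ le_top)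
  have hvw : stabilizer G v ≠ stabilizer G w := fun e => hw e.le
  have hdist : ∀ x y : V, stabilizer G x = stabilizer G v → stabilizer G y = stabilizer G w →
      y ∉ orbit G x := by
    intro x y hx hy hxy
    rw [stabilizer_eq_of_mem_orbit hxy, hx] at hy
    exact hvw hy
  obtain ⟨v', hv', ev'⟩ := hpair v hv
  obtain ⟨w', hw', ew'⟩ := hpair w hw1
  obtain ⟨v'', hv1, hv2, ev''⟩ := htriple v v' hv hv' ev'
  obtain ⟨w'', hw1', hw2, ew''⟩ := htriple w w' hw1 hw' ew'
  have hs := sum_index_le (G := G) [v, v', v'', w, w', w''] (by simp [*])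
  simp [ev', ev'', ew', ew'', hne v hv, hne w hw1] at hs
  rcases hp with rfl | rfl <;> omega

end IsFullAut

namespace IsFullAut

open MulAction

variable {V : Type*} {Γ : SimpleGraph V} {G : Type*} [CommGroup G] [MulAction G V]

theorem exists_smul_ne (h : IsFullAut Γ G) {g : G} (hg : g ≠ 1) : ∃ v : V, g • v ≠ v := by
  by_contra! hcon
  exact hg (h.eq_one g hcon)

/-- The group `C₂ × C₄`. -/
abbrev C2C4 := Multiplicative (ZMod 2 × ZMod 4)

theorem lt_card_of_two_four [Finite V] [MulAction C2C4 V]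
    (h : IsFullAut Γ C2C4) : 8 < Nat.card V := by
  let z : C2C4 := Multiplicative.ofAdd (0, 2)
  have hcard : Nat.card C2C4 = 8 := by
    rw [Nat.card_eq_fintype_card]
    rfl
  have hsq : ∀ g : C2C4, g ^ 2 = 1 ∨ g ^ 2 = z := by decide
  have hsmall : ∀ K : Subgroup C2C4, z ∉ K → Nat.card K ≤ 2 := by
    intro K hz
    let a : C2C4 := Multiplicative.ofAdd (1, 0)
    have h1 : ∀ g : C2C4, g = 1 ∨ g = a ∨ g = z * a ∨ g = z ∨ g ^ 2 = z := by decide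
    have h2 : a * (z * a) = z := by decide
    have hle : ∃ b : C2C4, (K : Set C2C4) ⊆ {1, b} := by
      by_cases ha : a ∈ K
      · refine ⟨a, fun g hg => ?_⟩
        rcases h1 g with e | e | e | e | e
        · simp [e]
        · simp [e]
        · subst e
          exact (hz (h2 ▸ K.mul_mem ha hg)).elim
        · exact (hz (e ▸ hg)).elim
        · exact (hz (e ▸ K.pow_mem hg 2)).elim
      · refine ⟨z * a, fun g hg => ?_⟩
        rcases h1 g with e | e | e | e | e
        · simp [e]
        · exact (ha (e ▸ hg)).elim
        · simp [e]
        · exact (hz (e ▸ hg)).elim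
        · exact (hz (e ▸ K.pow_mem hg 2)).elim
    obtain ⟨b, hb⟩ := hle
    exact (Set.ncard_le_ncard hb).trans (Set.ncard_insert_le _ _ |>.trans (by simp))
  by_contra! hlt
  obtain ⟨v, hv⟩ := h.exists_smul_ne (g := z) (by decide)
  obtain ⟨w, hw, g, hg⟩ := h.exists_of_single (v := v) (g := Multiplicative.ofAdd (0, 1)) hv
  rcases hsq g with e | e
  · exact hg (e ▸ Subgroup.one_mem _)
  rw [e] at hg
  have hs := sum_index_le (G := C2C4) [v, w] (by simpa using hw)
  simp at hs
  have c0 := hsmall _ hg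
  have cv := hsmall _ fun hz => hg (Subgroup.mem_sup_left hz)
  have cw := hsmall _ fun hz => hg (Subgroup.mem_sup_right hz)
  have iv := (stabilizer C2C4 v).card_mul_index
  have iw := (stabilizer C2C4 w).card_mul_index
  rw [hcard] at iv iw
  have hiv : (stabilizer C2C4 v).index = 4 := by
    interval_cases hc : Nat.card (stabilizer C2C4 v) <;>
      interval_cases hc : Nat.card (stabilizer C2C4 w) <;> omega
  have hiw : (stabilizer C2C4 w).index = 4 := by
    interval_cases hc : Nat.card (stabilizer C2C4 v) <;>
      interval_cases hc : Nat.card (stabilizer C2C4 w) <;> omega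
  rw [hiv] at iv
  rw [hiw] at iw
  have ev := Subgroup.eq_of_le_of_card_ge
    (le_sup_left : stabilizer C2C4 v ≤ stabilizer C2C4 v ⊔ stabilizer C2C4 w) (by omega)
  have ew := Subgroup.eq_of_le_of_card_ge
    (le_sup_right : stabilizer C2C4 w ≤ stabilizer C2C4 v ⊔ stabilizer C2C4 w) (by omega)
  have hnb : stabilizer C2C4 v ≠ ⊥ := by
    intro e
    rw [e, Subgroup.card_bot] at iv
    omega
  obtain ⟨k, hk, hk1⟩ := Subgroup.ne_bot_iff_exists_ne_one.1 hnb |>.elim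
    fun k hk => (⟨k.1, k.2, fun e => hk (Subtype.ext e)⟩ : ∃ k, k ∈ stabilizer C2C4 v ∧ k ≠ 1)
  obtain ⟨x, hx⟩ := h.exists_smul_ne hk1
  have hxv : x ∉ orbit C2C4 v := fun hxv => hx (by
    rwa [← stabilizer_eq_of_mem_orbit hxv, mem_stabilizer_iff] at hk)
  have hxw : x ∉ orbit C2C4 w := fun hxw => hx (by
    rwa [ev, ← ew, ← stabilizer_eq_of_mem_orbit hxw, mem_stabilizer_iff] at hk)
  have hx0 := (stabilizer C2C4 x).index_ne_zero_of_finite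
  have hs := sum_index_le (G := C2C4) [v, w, x] (by simp [hw, hxv, hxw])
  simp at hs
  omega

/-- The group `C₄ × C₄`. -/
abbrev C4C4 := Multiplicative (ZMod 4 × ZMod 4)

theorem lt_card_of_four_four [Finite V] [MulAction C4C4 V]
    (h : IsFullAut Γ C4C4) : 16 < Nat.card V := by
  have hcard : Nat.card C4C4 = 16 := by
    rw [Nat.card_eq_fintype_card]
    rfl
  have hinv : ∀ K : Subgroup C4C4, ∀ e ∈ K, ∀ f ∈ K, e ≠ 1 → f ≠ 1 → e ^ 2 = 1 → f ^ 2 = 1 →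
      e ≠ f → ∀ g : C4C4, g ^ 2 ∈ K := by
    intro K e he f hf he1 hf1 he2 hf2 hne g
    let a : C4C4 := Multiplicative.ofAdd (2, 0)
    let b : C4C4 := Multiplicative.ofAdd (0, 2)
    have h1 : ∀ g : C4C4, g ≠ 1 → g ^ 2 = 1 → g = a ∨ g = b ∨ g = a * b := by decide
    have h2 : ∀ g : C4C4, g ^ 2 = 1 ∨ g ^ 2 = a ∨ g ^ 2 = b ∨ g ^ 2 = a * b := by decide
    have h3 : a * (a * b) = b := by decide
    have h4 : b * (a * b) = a := by decide
    have key : a ∈ K ∧ b ∈ K := by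
      rcases h1 e he1 he2 with rfl | rfl | rfl <;> rcases h1 f hf1 hf2 with rfl | rfl | rfl
      · exact (hne rfl).elim
      · exact ⟨he, hf⟩
      · exact ⟨he, h3 ▸ K.mul_mem he hf⟩
      · exact ⟨hf, he⟩
      · exact (hne rfl).elim
      · exact ⟨h4 ▸ K.mul_mem he hf, he⟩
      · exact ⟨hf, h3 ▸ K.mul_mem hf he⟩
      · exact ⟨h4 ▸ K.mul_mem hf he, hf⟩
      · exact (hne rfl).elim
    rcases h2 g with e | e | e | e <;> rw [e]
    · exact K.one_mem
    · exact key.1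
    · exact key.2
    · exact K.mul_mem key.1 key.2
  have hexinv : ∀ K : Subgroup C4C4, K.index < 16 → ∃ e ∈ K, e ≠ 1 ∧ e ^ 2 = 1 := by
    intro K hK
    have hnb : K ≠ ⊥ := by
      rintro rfl
      rw [Subgroup.index_bot, hcard] at hK
      omega
    obtain ⟨k, hk, hk1⟩ := Subgroup.ne_bot_iff_exists_ne_one.1 hnb |>.elim
      fun k hk => (⟨k.1, k.2, fun e => hk (Subtype.ext e)⟩ : ∃ k, k ∈ K ∧ k ≠ 1)
    have : ∀ k : C4C4, (k ^ 2) ^ 2 = 1 := by decide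
    by_cases h2 : k ^ 2 = 1
    · exact ⟨k, hk, hk1, h2⟩
    · exact ⟨k ^ 2, K.pow_mem hk 2, h2, this k⟩
  have hidx : ∀ K : Subgroup C4C4, (∃ g : C4C4, g ^ 2 ∉ K) → 4 ≤ K.index := by
    rintro K ⟨g, hg⟩
    have h0 := K.index_ne_zero_of_finite
    have hd : K.index ∣ 16 := hcard ▸ K.index_dvd_card
    by_contra! hlt
    have : K.index ∣ 2 := by interval_cases K.index <;> omega
    exact hg (K.sq_mem_of_gcd_index_dvd_two (e := 16)
      (fun g => hcard ▸ pow_card_eq_one') ((Nat.gcd_dvd_right _ _).trans this) g)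
  have hroot : ∀ e : C4C4, e ^ 2 = 1 → ∃ g : C4C4, g ^ 2 = e := by decide
  by_contra! hlt
  have hpair : ∀ e : C4C4, e ≠ 1 → e ^ 2 = 1 → ∀ v : V, e • v ≠ v → ∃ w, w ∉ orbit C4C4 v ∧
      (∃ g : C4C4, g ^ 2 ∉ stabilizer C4C4 v ⊔ stabilizer C4C4 w) ∧ 4 ≤ (stabilizer C4C4 v).index ∧
      4 ≤ (stabilizer C4C4 w).index ∧
      4 ≤ (stabilizer C4C4 v ⊔ stabilizer C4C4 w).index := by
    intro e he1 he2 v hv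
    obtain ⟨g, rfl⟩ := hroot e he2
    obtain ⟨w, hw, g, hg⟩ := h.exists_of_single hv
    exact ⟨w, hw, ⟨g, hg⟩, hidx _ ⟨g, fun hz => hg (Subgroup.mem_sup_left hz)⟩,
      hidx _ ⟨g, fun hz => hg (Subgroup.mem_sup_right hz)⟩, hidx _ ⟨g, hg⟩⟩
  obtain ⟨v, hv⟩ := h.exists_smul_ne (g := Multiplicative.ofAdd (0, 2)) (by decide)
  obtain ⟨v', hv', ⟨g, hg⟩, iv, iv', ivv⟩ := hpair _ (by decide) (by decide) v hv
  have hs := sum_index_le (G := C4C4) [v, v'] (by simpa using hv')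
  simp at hs
  obtain ⟨e, he, he1, he2⟩ := hexinv (stabilizer C4C4 v) (by omega)
  obtain ⟨e', he', he1', he2'⟩ := hexinv (stabilizer C4C4 v') (by omega)
  have ee : e = e' := by
    by_contra hne
    exact hg (hinv _ e (Subgroup.mem_sup_left he) e' (Subgroup.mem_sup_right he') he1 he1'
      he2 he2' hne g)
  subst ee
  obtain ⟨w, hw⟩ := h.exists_smul_ne he1
  obtain ⟨w', hw', ⟨g', hg'⟩, iw, iw', iww⟩ := hpair e he1 he2 w hw
  have hs := sum_index_le (G := C4C4) [w, w'] (by simpa using hw')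
  simp at hs
  obtain ⟨f, hf, hf1, hf2⟩ := hexinv (stabilizer C4C4 w) (by omega)
  have hef : e ≠ f := by
    rintro rfl
    exact hw hf
  have hew₂ : e ∉ stabilizer C4C4 w' := fun hcon =>
    hg' (hinv _ e (Subgroup.mem_sup_right hcon) f (Subgroup.mem_sup_left hf) he1 hf1
      he2 hf2 hef g')
  have hwv : w ∉ orbit C4C4 v := fun ho => hw (by
    rwa [← stabilizer_eq_of_mem_orbit ho] at he)
  have hwv' : w ∉ orbit C4C4 v' := fun ho => hw (by
    rwa [← stabilizer_eq_of_mem_orbit ho] at he')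
  have hvw₁ : w' ∉ orbit C4C4 v := fun ho => hew₂ (by
    rwa [← stabilizer_eq_of_mem_orbit ho] at he)
  have hvw₂ : w' ∉ orbit C4C4 v' := fun ho => hew₂ (by
    rwa [← stabilizer_eq_of_mem_orbit ho] at he')
  have hs := sum_index_le (G := C4C4) [v, v', w, w'] (by simp [*])
  simp at hs
  have hall : ∀ x : V, x ∈ orbit C4C4 v ∨ x ∈ orbit C4C4 v' ∨ x ∈ orbit C4C4 w ∨
      x ∈ orbit C4C4 w' := by
    intro x
    by_contra! hx
    obtain ⟨h1, h2, h3, h4⟩ := hx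
    have hx0 := (stabilizer C4C4 x).index_ne_zero_of_finite
    have hs := sum_index_le (G := C4C4) [v, v', w, w', x] (by simp [*])
    simp at hs
    omega
  have heq : ∀ x y : V, (stabilizer C4C4 x).index = 4 → (stabilizer C4C4 y).index = 4 →
      4 ≤ (stabilizer C4C4 x ⊔ stabilizer C4C4 y).index →
      stabilizer C4C4 x = stabilizer C4C4 y := by
    intro x y ix iy ixy
    have h1 := (stabilizer C4C4 x).card_mul_index
    have h2 := (stabilizer C4C4 y).card_mul_index
    have h3 := (stabilizer C4C4 x ⊔ stabilizer C4C4 y).card_mul_index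
    rw [hcard] at h1 h2 h3
    rw [ix] at h1
    rw [iy] at h2
    have : Nat.card ↥(stabilizer C4C4 x ⊔ stabilizer C4C4 y) ≤ 4 := by nlinarith
    exact (Subgroup.eq_of_le_of_card_ge le_sup_left (by omega)).trans
      (Subgroup.eq_of_le_of_card_ge le_sup_right (by omega)).symm
  have evv := heq v v' (by omega) (by omega) ivv
  have eww := heq w w' (by omega) (by omega) iww
  have hinf : stabilizer C4C4 v ⊓ stabilizer C4C4 w = ⊥ := by
    rw [eq_bot_iff]
    intro k hk
    refine h.eq_one k fun x => ?_
    change k ∈ stabilizer C4C4 x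
    rcases hall x with hx | hx | hx | hx <;> rw [stabilizer_eq_of_mem_orbit hx]
    · exact hk.1
    · exact evv ▸ hk.1
    · exact hk.2
    · exact eww ▸ hk.2
  have hsup : stabilizer C4C4 v ⊔ stabilizer C4C4 w = ⊤ := by
    have h1 := (stabilizer C4C4 v).card_mul_index
    have h2 := (stabilizer C4C4 w).card_mul_index
    rw [show (stabilizer C4C4 v).index = 4 by omega, hcard] at h1
    rw [show (stabilizer C4C4 w).index = 4 by omega, hcard] at h2
    have h3 : Nat.card (stabilizer C4C4 v) = 4 := by omega
    have h4 : Nat.card (stabilizer C4C4 w) = 4 := by omega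
    exact (Subgroup.isComplement'_of_card_mul_and_disjoint (by rw [h3, h4, hcard])
      (disjoint_iff.2 hinf)).sup_eq_top
  obtain ⟨u, hu1, hu2, hu⟩ := h.exists_of_pair' (g := Multiplicative.ofAdd (0, 1)) hv' hv
    (by rw [← evv, sup_idem]; omega)
  rcases hall u with hx | hx | hx | hx
  · exact hu1 hx
  · exact hu2 hx
  · rw [stabilizer_eq_of_mem_orbit hx, ← evv, or_self] at hu
    exact hu hsup
  · rw [stabilizer_eq_of_mem_orbit hx, ← evv, ← eww, or_self] at hu
    exact hu hsup

end IsFullAut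

theorem Subgroup.mem_of_pow_eq_one_of_coprime_index {G : Type*} [CommGroup G]
    (H : Subgroup G) {g : G} {n : ℕ} (hg : g ^ n = 1) (h : n.Coprime H.index) : g ∈ H := by
  have h1 : orderOf (g : G ⧸ H) ∣ n := orderOf_dvd_of_pow_eq_one (by
    rw [← QuotientGroup.mk_pow, hg]; rfl)
  have h2 : orderOf (g : G ⧸ H) ∣ H.index := _root_.orderOf_dvd_natCard _
  have h3 := Nat.dvd_gcd h1 h2
  rw [h, Nat.dvd_one, orderOf_eq_one_iff] at h3
  rwa [QuotientGroup.eq_one_iff] at h3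

theorem Subgroup.sq_dvd_card_of_notMem_zpowers {G : Type*} [CommGroup G] [Finite G]
    (H : Subgroup G) {p : ℕ} (hp : p.Prime) {s t : G} (hs : orderOf s = p) (ht : orderOf t = p)
    (hsH : s ∈ H) (htH : t ∈ H) (hst : s ∉ Subgroup.zpowers t) : p ^ 2 ∣ Nat.card H := by
  have h1 : (zpowers t).relIndex (zpowers s ⊔ zpowers t) = p := by
    rw [Subgroup.relIndex_sup_right]
    have hd : (zpowers t).relIndex (zpowers s) ∣ Nat.card (zpowers s) :=
      Subgroup.relIndex_dvd_card _ _
    rw [Nat.card_zpowers, hs, Nat.dvd_prime hp] at hd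
    refine hd.resolve_left fun e => hst ?_
    rw [Subgroup.relIndex_eq_one] at e
    exact e (mem_zpowers s)
  have h2 := Subgroup.relIndex_mul_relIndex ⊥ (zpowers t) (zpowers s ⊔ zpowers t) bot_le
    le_sup_right
  rw [h1, Subgroup.relIndex_bot_left, Subgroup.relIndex_bot_left, Nat.card_zpowers, ht] at h2
  rw [sq, h2]
  exact Subgroup.card_dvd_of_le (sup_le ((zpowers_le).2 hsH) ((zpowers_le).2 htH))

theorem Subgroup.exists_orderOf_eq_of_dvd_card {G : Type*} [Group G] [Finite G] (H : Subgroup G)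
    {p : ℕ} (hp : p.Prime) (h : p ∣ Nat.card H) : ∃ g ∈ H, orderOf g = p := by
  have := Fact.mk hp
  obtain ⟨g, hg⟩ := exists_prime_orderOf_dvd_card' (G := H) p h
  exact ⟨g, g.2, by rw [Subgroup.orderOf_coe, hg]⟩

namespace IsFullAut

open MulAction

variable {V : Type*} {Γ : SimpleGraph V} {G : Type*} [CommGroup G] [MulAction G V]

theorem exists_three_dvd_index [Finite V] [Finite G] (h : IsFullAut Γ G) {v : V}
    (hexp : ∀ g : G, g ^ 6 = 1) (hv : 3 ∣ (stabilizer G v).index) :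
    ∃ w, w ∉ orbit G v ∧ 3 ∣ (stabilizer G v ⊔ stabilizer G w).index := by
  obtain ⟨g, hg⟩ :=
    (stabilizer G v).exists_sq_notMem_of_prime_dvd_index Nat.prime_three (by decide) hv
  obtain ⟨w, hw, g, hg⟩ := h.exists_of_single hg
  refine ⟨w, hw, ?_⟩
  by_contra hcon
  refine hg (Subgroup.sq_mem_of_gcd_index_dvd_two _ hexp ?_ g)
  rw [show 6 = 2 * 3 from rfl, Nat.Coprime.gcd_mul_right_cancel 2
    ((Nat.Prime.coprime_iff_not_dvd Nat.prime_three).2 hcon)]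
  exact Nat.gcd_dvd_left _ _

theorem exists_three_dvd_index_of_pair [Finite V] [Finite G] (h : IsFullAut Γ G) {v w : V}
    (hexp : ∀ g : G, g ^ 6 = 1) (hw : w ∉ orbit G v)
    (hvw : (stabilizer G v ⊔ stabilizer G w).index = 3) :
    ∃ u, u ∉ orbit G v ∧ u ∉ orbit G w ∧ (3 ∣ (stabilizer G v ⊔ stabilizer G u).index ∨
      3 ∣ (stabilizer G w ⊔ stabilizer G u).index) := by
  have hv : 3 ∣ (stabilizer G v).index := hvw ▸ Subgroup.index_dvd_of_le le_sup_left
  obtain ⟨g, hg⟩ :=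
    (stabilizer G v).exists_sq_notMem_of_prime_dvd_index Nat.prime_three (by decide) hv
  obtain ⟨u, hu1, hu2, hu⟩ := h.exists_of_pair hw hg (by omega) (by rw [hvw]; decide)
  refine ⟨u, hu1, hu2, ?_⟩
  by_contra! hcon
  have key : ∀ H : Subgroup G, ¬ 3 ∣ H.index → ∀ g : G, g ^ 2 ∈ H := fun H hH =>
    Subgroup.sq_mem_of_gcd_index_dvd_two _ hexp (by
      rw [show 6 = 2 * 3 from rfl, Nat.Coprime.gcd_mul_right_cancel 2
        ((Nat.Prime.coprime_iff_not_dvd Nat.prime_three).2 hH)]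
      exact Nat.gcd_dvd_left _ _)
  rcases hu with ⟨g, hg⟩ | ⟨g, hg⟩
  · exact hg (key _ hcon.1 g)
  · exact hg (key _ hcon.2 g)

theorem prime_dvd_index_of_smul_ne {v : V} {p : ℕ} (hp : p.Prime) {g : G} (hg : orderOf g = p)
    (hv : g • v ≠ v) : p ∣ (stabilizer G v).index := by
  by_contra hcon
  exact hv (Subgroup.mem_of_pow_eq_one_of_coprime_index _ (orderOf_dvd_iff_pow_eq_one.1 hg.dvd)
    ((Nat.Prime.coprime_iff_not_dvd hp).2 hcon))

theorem exists_prime_dvd_index (h : IsFullAut Γ G) {p : ℕ} (hp : p.Prime) {g : G}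
    (hg : orderOf g = p) : ∃ v : V, g • v ≠ v ∧ p ∣ (stabilizer G v).index := by
  have h1 : g ≠ 1 := by
    rintro rfl
    rw [orderOf_one] at hg
    exact hp.one_lt.ne hg
  obtain ⟨v, hv⟩ := h.exists_smul_ne h1
  exact ⟨v, hv, prime_dvd_index_of_smul_ne hp hg hv⟩

theorem lt_card_of_card_eq_twelve [Finite V] [Finite G] (h : IsFullAut Γ G)
    (hG : Nat.card G = 12) (hexp : ∀ g : G, g ^ 6 = 1) : 12 < Nat.card V := by
  have hpos : ∀ v : V, 0 < (stabilizer G v).index := fun v =>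
    Nat.pos_of_ne_zero (stabilizer G v).index_ne_zero_of_finite
  have hdvd : ∀ K : Subgroup G, K.index = 1 ∨ K.index = 2 ∨ K.index = 3 ∨ K.index = 4 ∨
      K.index = 6 ∨ K.index = 12 := by
    intro K
    have h1 : K.index ∣ 12 := hG ▸ K.index_dvd_card
    have : K.index ≤ 12 := Nat.le_of_dvd (by norm_num) h1
    have h0 := K.index_ne_zero_of_finite
    interval_cases K.index <;> omega
  have hcard : ∀ K : Subgroup G, Nat.card K * K.index = 12 := fun K => hG ▸ K.card_mul_index
  by_contra! hlt
  obtain ⟨s, -, hs⟩ := (⊤ : Subgroup G).exists_orderOf_eq_of_dvd_card Nat.prime_three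
    (by rw [Subgroup.card_top, hG]; decide)
  obtain ⟨v, -, hv⟩ := h.exists_prime_dvd_index Nat.prime_three hs
  obtain ⟨w, hw, hvw⟩ := h.exists_three_dvd_index hexp hv
  have hiw : 3 ∣ (stabilizer G w).index := hvw.trans (Subgroup.index_dvd_of_le le_sup_right)
  have hsum := sum_index_le (G := G) [v, w] (by simpa using hw)
  simp at hsum
  have hv0 := hpos v
  have hw0 := hpos w
  have hdv := Nat.le_of_dvd hv0 (Subgroup.index_dvd_of_le
    (le_sup_left : stabilizer G v ≤ stabilizer G v ⊔ stabilizer G w))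
  have hdw := Nat.le_of_dvd hw0 (Subgroup.index_dvd_of_le
    (le_sup_right : stabilizer G w ≤ stabilizer G v ⊔ stabilizer G w))
  have cv := hcard (stabilizer G v)
  have cw := hcard (stabilizer G w)
  have cvw := hcard (stabilizer G v ⊔ stabilizer G w)
  have h36 : (stabilizer G v ⊔ stabilizer G w).index = 3 ∨
      (stabilizer G v ⊔ stabilizer G w).index = 6 := by
    rcases hdvd (stabilizer G v ⊔ stabilizer G w) with e | e | e | e | e | e <;> omega
  rcases h36 with h3 | h6
  swap
  · have iv : (stabilizer G v).index = 6 := by omega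
    have iw : (stabilizer G w).index = 6 := by omega
    rw [iv] at cv
    rw [iw] at cw
    rw [h6] at cvw
    have evw := (Subgroup.eq_of_le_of_card_ge
      (le_sup_left : stabilizer G v ≤ stabilizer G v ⊔ stabilizer G w) (by omega)).trans
      (Subgroup.eq_of_le_of_card_ge (le_sup_right : stabilizer G w ≤ _) (by omega)).symm
    obtain ⟨t, ht, hot⟩ := (stabilizer G v).exists_orderOf_eq_of_dvd_card Nat.prime_two (by omega)
    obtain ⟨x, hx, -⟩ := h.exists_prime_dvd_index Nat.prime_two hot
    have hxv : x ∉ orbit G v := fun ho => hx (by rwa [← stabilizer_eq_of_mem_orbit ho] at ht)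
    have hxw : x ∉ orbit G w := fun ho => hx (by
      rwa [evw, ← stabilizer_eq_of_mem_orbit ho] at ht)
    have hsum := sum_index_le (G := G) [v, w, x] (by simp [*])
    simp at hsum
    have := hpos x
    omega
  obtain ⟨u, huv, huw, hu⟩ := h.exists_three_dvd_index_of_pair hexp hw h3
  have hiu : 3 ∣ (stabilizer G u).index :=
    hu.elim (fun hu => hu.trans (Subgroup.index_dvd_of_le le_sup_right))
      fun hu => hu.trans (Subgroup.index_dvd_of_le le_sup_right)
  obtain ⟨t, -, ht⟩ := (⊤ : Subgroup G).exists_orderOf_eq_of_dvd_card Nat.prime_two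
    (by rw [Subgroup.card_top, hG]; decide)
  obtain ⟨x, -, hx⟩ := h.exists_prime_dvd_index Nat.prime_two ht
  have hx2 : (stabilizer G x).index = 2 ∨ (stabilizer G x).index = 6 →
      ∃ y, y ∉ orbit G x ∧ 2 ∣ (stabilizer G y).index := by
    intro hx
    have cx := hcard (stabilizer G x)
    obtain ⟨t, htx, ht⟩ := (stabilizer G x).exists_orderOf_eq_of_dvd_card Nat.prime_two (by
      rcases hx with e | e <;> rw [e] at cx <;> omega)
    obtain ⟨y, hy, hy2⟩ := h.exists_prime_dvd_index Nat.prime_two ht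
    exact ⟨y, fun ho => hy (by rwa [← stabilizer_eq_of_mem_orbit ho] at htx), hy2⟩
  have hu0 := hpos u
  have key : ∀ a b c : V, b ∉ orbit G a → c ∉ orbit G a → c ∉ orbit G b →
      3 ∣ (stabilizer G a).index → 3 ∣ (stabilizer G b).index →
      3 ∣ (stabilizer G c).index → x ∉ orbit G a := by
    intro a b c hba hca hcb ha hb hc hxa
    have ha0 := hpos a
    have hb0 := hpos b
    have hc0 := hpos c
    have e := stabilizer_eq_of_mem_orbit hxa
    have hsum := sum_index_le (G := G) [a, b, c] (by simp [*])
    simp at hsum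
    have ha6 : (stabilizer G a).index = 6 := by
      rw [e] at hx
      omega
    obtain ⟨y, hy, hy2⟩ := hx2 (Or.inr (by rw [e, ha6]))
    have hya : y ∉ orbit G a := by rwa [← orbit_eq_iff.2 hxa]
    have hyb : y ∉ orbit G b := notMem_orbit_of_index_ne (by omega)
    have hyc : y ∉ orbit G c := notMem_orbit_of_index_ne (by omega)
    have hsum := sum_index_le (G := G) [a, b, c, y] (by simp [*])
    simp at hsum
    have := hpos y
    omega
  have hxv := key v w u hw huv huw hv hiw hiu
  have hxw := key w v u (notMem_orbit_comm.1 hw) huw huv hiw hv hiu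
  have hxu := key u v w (notMem_orbit_comm.1 huv) (notMem_orbit_comm.1 huw) hw hiu hv hiw
  have hsum := sum_index_le (G := G) [v, w, u, x] (by simp [*])
  simp at hsum
  have hx0 := hpos x
  obtain ⟨y, hy, hy2⟩ := hx2 (Or.inl (by omega))
  have hyv : y ∉ orbit G v := notMem_orbit_of_index_ne (by omega)
  have hyw : y ∉ orbit G w := notMem_orbit_of_index_ne (by omega)
  have hyu : y ∉ orbit G u := notMem_orbit_of_index_ne (by omega)
  have hsum := sum_index_le (G := G) [v, w, u, x, y] (by simp [*])
  simp at hsum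
  have := hpos y
  omega

end IsFullAut

theorem Subgroup.mem_of_three_dvd_index_sup {G : Type*} [CommGroup G] [Finite G]
    (hG : Nat.card G = 18) (H K : Subgroup G) {s : G} (hs : orderOf s = 3) (hsH : s ∈ H)
    (hK : 3 ∣ Nat.card K) (h : 3 ∣ (H ⊔ K).index) : s ∈ K := by
  obtain ⟨t, htK, ht⟩ := K.exists_orderOf_eq_of_dvd_card Nat.prime_three hK
  by_contra hsK
  have h9 := (H ⊔ K).sq_dvd_card_of_notMem_zpowers Nat.prime_three hs ht (mem_sup_left hsH)
    (mem_sup_right htK) fun hst => hsK ((zpowers_le).2 htK hst)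
  have := mul_dvd_mul h9 h
  rw [Subgroup.card_mul_index, hG] at this
  omega

namespace IsFullAut

open MulAction

variable {V : Type*} {Γ : SimpleGraph V} {G : Type*} [CommGroup G] [MulAction G V]

theorem index_eq_of_card_eq_eighteen [Finite V] [Finite G] (h : IsFullAut Γ G)
    (hG : Nat.card G = 18) (hexp : ∀ g : G, g ^ 6 = 1) (hlt : Nat.card V ≤ 18) (v : V) :
    (stabilizer G v).index = 1 ∨ (stabilizer G v).index = 2 ∨ (stabilizer G v).index = 3 ∨
      (stabilizer G v).index = 6 ∨ (stabilizer G v).index = 9 := by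
  have h1 : (stabilizer G v).index ∣ 18 := hG ▸ (stabilizer G v).index_dvd_card
  have h2 := Nat.le_of_dvd (by norm_num) h1
  have h0 := (stabilizer G v).index_ne_zero_of_finite
  have h3 : (stabilizer G v).index ≠ 18 := by
    intro e
    obtain ⟨w, hw, -⟩ := h.exists_three_dvd_index (v := v) hexp (by rw [e]; decide)
    have hs := sum_index_le (G := G) [v, w] (by simp [*])
    simp at hs
    have := (stabilizer G w).index_ne_zero_of_finite
    omega
  interval_cases (stabilizer G v).index <;> omega

theorem lt_card_of_forall_index_ne_nine [Finite V] [Finite G] (h : IsFullAut Γ G)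
    (hG : Nat.card G = 18) (hexp : ∀ g : G, g ^ 6 = 1)
    (h9 : ∀ v : V, (stabilizer G v).index ≠ 9) : 18 < Nat.card V := by
  by_contra! hlt
  have hidx := h.index_eq_of_card_eq_eighteen hG hexp hlt
  have hle : ∀ u v : V, 3 ∣ (stabilizer G u ⊔ stabilizer G v).index →
      3 ∣ (stabilizer G u).index ∧ 3 ∣ (stabilizer G v).index :=
    fun u v huv => ⟨huv.trans (Subgroup.index_dvd_of_le le_sup_left),
      huv.trans (Subgroup.index_dvd_of_le le_sup_right)⟩
  have hstar : ∀ u v : V, ∀ s : G, orderOf s = 3 → s ∈ stabilizer G u →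
      3 ∣ (stabilizer G u ⊔ stabilizer G v).index → s ∈ stabilizer G v := by
    intro u v s hs hsu huv
    refine Subgroup.mem_of_three_dvd_index_sup hG _ _ hs hsu ?_ huv
    have h1 := (stabilizer G v).card_mul_index
    have h2 := (hle u v huv).2
    have h3 := h9 v
    rcases hidx v with e | e | e | e | e <;> rw [e, hG] at h1 <;> omega
  obtain ⟨s, -, hs⟩ := (⊤ : Subgroup G).exists_orderOf_eq_of_dvd_card Nat.prime_three
    (by rw [Subgroup.card_top, hG]; decide)
  obtain ⟨v, -, hv⟩ := h.exists_prime_dvd_index Nat.prime_three hs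
  obtain ⟨s, hsv, hs⟩ := (stabilizer G v).exists_orderOf_eq_of_dvd_card Nat.prime_three (by
    have h1 := (stabilizer G v).card_mul_index
    have h3 := h9 v
    rcases hidx v with e | e | e | e | e <;> rw [e, hG] at h1 <;> omega)
  obtain ⟨w, hsw, hw⟩ := h.exists_prime_dvd_index Nat.prime_three hs
  obtain ⟨v', hv', hvv⟩ := h.exists_three_dvd_index hexp hv
  obtain ⟨w', hw', hww⟩ := h.exists_three_dvd_index hexp hw
  have hsv' := hstar v v' s hs hsv hvv
  have hsw' : s ∉ stabilizer G w' := fun hc =>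
    hsw (hstar w' w s hs hc (by rwa [sup_comm]))
  have hdist : ∀ x y : V, s ∈ stabilizer G x → s ∉ stabilizer G y → y ∉ orbit G x := by
    intro x y hx hy hxy
    rw [stabilizer_eq_of_mem_orbit hxy] at hy
    exact hy hx
  have h1 := hdist v w hsv hsw
  have h2 := hdist v' w hsv' hsw
  have h3 := hdist v w' hsv hsw'
  have h4 := hdist v' w' hsv' hsw'
  have hsum := sum_index_le (G := G) [v, v', w, w'] (by simp [*])
  simp at hsum
  have h5 := hle _ _ hvv
  have h6 := hle _ _ hww
  have iv := hidx v
  have iw := hidx w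
  have iv' := hidx v'
  have iw' := hidx w'
  have hpair : ∀ x y : V, y ∉ orbit G x → 3 ∣ (stabilizer G x ⊔ stabilizer G y).index →
      (stabilizer G x).index = 3 ∨ (stabilizer G y).index = 3 →
      ∃ u, u ∉ orbit G x ∧ u ∉ orbit G y ∧ 3 ∣ (stabilizer G u).index ∧
        (s ∈ stabilizer G x → s ∈ stabilizer G y → s ∈ stabilizer G u) ∧
        (s ∉ stabilizer G x → s ∉ stabilizer G y → s ∉ stabilizer G u) := by
    intro x y hxy h3 hor
    have hi : (stabilizer G x ⊔ stabilizer G y).index = 3 := by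
      refine Nat.dvd_antisymm ?_ h3
      rcases hor with e | e <;> rw [← e]
      · exact Subgroup.index_dvd_of_le le_sup_left
      · exact Subgroup.index_dvd_of_le le_sup_right
    obtain ⟨u, hu1, hu2, hu⟩ := h.exists_three_dvd_index_of_pair hexp hxy hi
    refine ⟨u, hu1, hu2, hu.elim (fun hu => (hle _ _ hu).2) fun hu => (hle _ _ hu).2, ?_, ?_⟩
    · intro hx hy
      exact hu.elim (hstar x u s hs hx) (hstar y u s hs hy)
    · intro hx hy hsu
      refine hu.elim (fun hu => hx (hstar u x s hs hsu (by rwa [sup_comm])))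
        fun hu => hy (hstar u y s hs hsu (by rwa [sup_comm]))
  by_cases c1 : (stabilizer G v).index = 3 ∨ (stabilizer G v').index = 3
  swap
  · obtain ⟨u, hu1, hu2, hu3, -, hu4⟩ := hpair w w' hw' hww (by omega)
    have hsu := hu4 hsw hsw'
    have h7 := hdist v u hsv hsu
    have h8 := hdist v' u hsv' hsu
    have hsum := sum_index_le (G := G) [v, v', w, w', u] (by simp [*])
    simp at hsum
    have := hidx u
    omega
  by_cases c2 : (stabilizer G w).index = 3 ∨ (stabilizer G w').index = 3
  swap
  · obtain ⟨u, hu1, hu2, hu3, hu4, -⟩ := hpair v v' hv' hvv (by omega)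
    have hsu := hu4 hsv hsv'
    have h7 := notMem_orbit_comm.1 (hdist u w hsu hsw)
    have h8 := notMem_orbit_comm.1 (hdist u w' hsu hsw')
    have hsum := sum_index_le (G := G) [v, v', w, w', u] (by simp [*])
    simp at hsum
    have := hidx u
    omega
  obtain ⟨u, hu1, hu2, hu3, hu4, -⟩ := hpair v v' hv' hvv c1
  obtain ⟨y, hy1, hy2, hy3, -, hy4⟩ := hpair w w' hw' hww c2
  have hsu := hu4 hsv hsv'
  have hsy := hy4 hsw hsw'
  have h7 := hdist u w hsu hsw
  have h8 := hdist u w' hsu hsw'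
  have h9 := hdist u y hsu hsy
  have h10 := hdist v y hsv hsy
  have h11 := hdist v' y hsv' hsy
  have hsum := sum_index_le (G := G) [v, v', u, w, w', y] (by simp [*])
  simp at hsum
  obtain ⟨t, -, ht⟩ := (⊤ : Subgroup G).exists_orderOf_eq_of_dvd_card Nat.prime_two
    (by rw [Subgroup.card_top, hG]; decide)
  obtain ⟨x, -, hx⟩ := h.exists_prime_dvd_index Nat.prime_two ht
  have iu := hidx u
  have iy := hidx y
  have k1 : x ∉ orbit G v := notMem_orbit_of_index_ne (by omega)
  have k2 : x ∉ orbit G v' := notMem_orbit_of_index_ne (by omega)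
  have k3 : x ∉ orbit G u := notMem_orbit_of_index_ne (by omega)
  have k4 : x ∉ orbit G w := notMem_orbit_of_index_ne (by omega)
  have k5 : x ∉ orbit G w' := notMem_orbit_of_index_ne (by omega)
  have k6 : x ∉ orbit G y := notMem_orbit_of_index_ne (by omega)
  have hsum := sum_index_le (G := G) [v, v', u, w, w', y, x] (by simp [*])
  simp at hsum
  have := (stabilizer G x).index_ne_zero_of_finite
  omega

/-- Case of three orbits whose stabilizers pairwise generate subgroups of index at most `3`, the
last two of them being linked trivially. -/
theorem sq_smul_eq_of_three [Finite V] [Finite G] (h : IsFullAut Γ G) {v w u : V}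
    (hw : w ∉ orbit G v) (hu : u ∉ orbit G v) (hwu : u ∉ orbit G w)
    (iw : (stabilizer G v ⊔ stabilizer G w).index = 3)
    (iu : (stabilizer G v ⊔ stabilizer G u).index ≤ 3)
    (iu' : Odd (stabilizer G v ⊔ stabilizer G u).index)
    (h1 : ∀ g : G, g ^ 2 ∈ stabilizer G w ⊔ stabilizer G u)
    (h2 : ∀ y, y ∉ orbit G v → y ∉ orbit G w → y ∉ orbit G u → ∀ g : G,
      g ^ 2 ∈ stabilizer G v ⊔ stabilizer G y ∧ g ^ 2 ∈ stabilizer G w ⊔ stabilizer G y ∧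
        g ^ 2 ∈ stabilizer G u ⊔ stabilizer G y) (g : G) : g ^ 2 • v = v := by
  obtain ⟨c, hc⟩ := h.exists_reflection_of_odd v w (by omega) (by rw [iw]; decide)
  obtain ⟨d, hd⟩ := h.exists_reflection_of_odd v u (by omega) iu'
  have hcw : stabilizer G (c • w) = stabilizer G w := stabilizer_eq_of_mem_orbit ⟨c, rfl⟩
  have hdu : stabilizer G (d • u) = stabilizer G u := stabilizer_eq_of_mem_orbit ⟨d, rfl⟩
  have hsymm : ∀ {x y : V}, (∀ g : G, Γ.Adj x (g • y) ↔ Γ.Adj x (g⁻¹ • y)) →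
      ∀ g : G, Γ.Adj y (g • x) ↔ Γ.Adj y (g⁻¹ • x) := by
    intro x y hxy g
    rw [Γ.adj_comm, ← h.adj_smul g⁻¹, inv_smul_smul, hxy, inv_inv, ← h.adj_smul g⁻¹,
      inv_smul_smul, Γ.adj_comm]
  have hcd : ∀ g : G, Γ.Adj (c • w) (g • d • u) ↔ Γ.Adj (c • w) (g⁻¹ • d • u) := by
    intro g
    have := h.adj_iff_of_mem_sup (u := c • w) (v := d • u) (a := g ^ 2)
      (by rw [hcw, hdu]; exact h1 g) g⁻¹
    rw [← this, sq, mul_smul, smul_inv_smul]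
  have hne : ∀ {x y : V} (a b g : G), y ∉ orbit G x → g • a • x ≠ b • y := by
    rintro x y a b g hxy e
    refine hxy ⟨b⁻¹ * (g * a), ?_⟩
    simp only [mul_smul] at e ⊢
    rw [e, inv_smul_smul]
  refine h.sq_smul_eq_of_reflection (![v, c • w, d • u] : Fin 3 → V) ?_ (fun _ => 1) ?_ ?_ 0 rfl g
  · intro i j g hij
    fin_cases i <;> fin_cases j <;> simp at hij ⊢
    · exact hne 1 c g hw (by rwa [one_smul])
    · exact hne 1 d g hu (by rwa [one_smul])
    · exact hne c 1 g (notMem_orbit_comm.1 hw) (by rwa [one_smul])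
    · exact hne c d g hwu hij
    · exact hne d 1 g (notMem_orbit_comm.1 hu) (by rwa [one_smul])
    · exact hne d c g (notMem_orbit_comm.1 hwu) hij
  · intro i j hij g
    fin_cases i <;> fin_cases j <;> simp at hij ⊢
    · exact hc g
    · exact hd g
    · exact hsymm hc g
    · exact hcd g
    · exact hsymm hd g
    · exact hsymm hcd g
  · intro y hy i g
    have hyv : y ∉ orbit G v := fun ⟨k, hk⟩ => hy 0 k hk
    have hyw : y ∉ orbit G w := fun ⟨k, hk⟩ => hy 1 (k * c⁻¹) (by
      simpa [mul_smul] using hk)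
    have hyu : y ∉ orbit G u := fun ⟨k, hk⟩ => hy 2 (k * d⁻¹) (by
      simpa [mul_smul] using hk)
    obtain ⟨e1, e2, e3⟩ := h2 y hyv hyw hyu g
    rw [one_mul, sup_comm]
    fin_cases i
    · exact e1
    · simpa [hcw] using e2
    · simpa [hdu] using e3

end IsFullAut

theorem Subgroup.exists_mul_mem_of_index_three {G : Type*} [CommGroup G] [Finite G]
    (N : Subgroup G) (hN : N.index = 3) {e : G} (he : e ∉ N) :
    ∀ x : G ⧸ N, x ∈ zpowers (e : G ⧸ N) := by
  have hp : Fact (Nat.Prime 3) := ⟨Nat.prime_three⟩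
  intro x
  refine mem_zpowers_of_prime_card (p := 3) hN ?_
  rwa [Ne, QuotientGroup.eq_one_iff]

theorem Subgroup.exists_eq_pow_mul_of_index_three {G : Type*} [CommGroup G] [Finite G]
    (N : Subgroup G) (hN : N.index = 3) {e : G} (he : e ∉ N) (g : G) :
    ∃ n ∈ N, g = n ∨ g = e * n ∨ g = e ^ 2 * n := by
  classical
  obtain ⟨k, hk, hk2⟩ := mem_zpowers_iff_mem_range_orderOf.1
    (N.exists_mul_mem_of_index_three hN he g) |> Finset.mem_image.1
  rw [Finset.mem_range] at hk
  have h3 : orderOf (e : G ⧸ N) ∣ 3 := hN ▸ _root_.orderOf_dvd_natCard _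
  have := Nat.le_of_dvd (by norm_num) h3
  have hmem : (e ^ k)⁻¹ * g ∈ N := by
    rw [← QuotientGroup.eq_one_iff, QuotientGroup.mk_mul, QuotientGroup.mk_inv,
      QuotientGroup.mk_pow]
    rw [hk2, inv_mul_cancel]
  refine ⟨_, hmem, ?_⟩
  have hk3 : k < 3 := by omega
  interval_cases k <;> simp

namespace IsFullAut

open MulAction

variable {V : Type*} {Γ : SimpleGraph V} {G : Type*} [CommGroup G] [MulAction G V]

/-- If `N` has index `3` and contains `K_v` as a subgroup of small index, and every other orbit
only sees the `N`-orbits in the orbit of `v`, then inverting `N` can be extended to a twist. -/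
theorem sq_smul_eq_of_index_three [Finite V] [Finite G] (h : IsFullAut Γ G) {v : V}
    (N : Subgroup G) (hN : N.index = 3) (hvN : stabilizer G v ≤ N)
    (hidx : (stabilizer G v).relIndex N ≤ 5) {e : G} (heN : e ∉ N) (he : e ^ 3 = 1)
    (hcube : ∀ n ∈ N, n ^ 3 ∈ stabilizer G v) (hfour : ∀ n ∈ N, (n ^ 4) ^ 3 = 1)
    (h2 : ∀ y, y ∉ orbit G v → ∀ n ∈ N, n ∈ stabilizer G y ⊔ stabilizer G v) :
    ∀ n ∈ N, n ^ 2 • v = v := by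
  have hTsymm : ∀ g : G, Γ.Adj v (g • v) ↔ Γ.Adj v (g⁻¹ • v) := by
    intro g
    rw [← h.adj_smul g⁻¹, inv_smul_smul, Γ.adj_comm]
  have hTK : ∀ k ∈ stabilizer G v, ∀ g : G, Γ.Adj v ((k * g) • v) ↔ Γ.Adj v (g • v) := by
    intro k hk g
    rw [mul_smul]
    exact h.adj_iff_of_mem_sup (Subgroup.mem_sup_left hk) g
  obtain ⟨c₀, hc₀, hrefl₀⟩ := exists_reflection_of_relIndex_le_five (stabilizer G v) N
    {g | Γ.Adj v ((e * g) • v)} (fun k hk g => by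
      simp only [Set.mem_ofPred_eq]
      rw [mul_left_comm]
      exact hTK k hk _) hidx
  simp only [Set.mem_ofPred_eq] at hrefl₀
  obtain ⟨c, hc, hc3, hrefl⟩ : ∃ c ∈ N, c ^ 3 = 1 ∧
      ∀ n ∈ N, Γ.Adj v ((e * n) • v) ↔ Γ.Adj v ((e * (c * n⁻¹)) • v) := by
    refine ⟨c₀ ^ 4, N.pow_mem hc₀ 4, hfour _ hc₀, fun n hn => ?_⟩
    rw [hrefl₀ n hn, ← hTK _ (hcube _ hc₀)]
    have : c₀ ^ 3 * (e * (c₀ * n⁻¹)) = e * (c₀ ^ 4 * n⁻¹) := by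
      rw [mul_left_comm, ← mul_assoc (c₀ ^ 3), ← pow_succ]
    rw [this]
  have hord : orderOf (e ^ 2 * c) ∣ orderOf (e : G ⧸ N) := by
    have h1 : orderOf (e : G ⧸ N) = 3 := by
      refine ((Nat.dvd_prime Nat.prime_three).1 (hN ▸ _root_.orderOf_dvd_natCard _)).resolve_left ?_
      rwa [orderOf_eq_one_iff, QuotientGroup.eq_one_iff]
    rw [h1]
    refine orderOf_dvd_of_pow_eq_one ?_
    rw [mul_pow, hc3, ← pow_mul, mul_comm 2 3, pow_mul, he, one_pow, one_mul]
  let ψ : G ⧸ N →* G := monoidHomOfForallMemZpowers (N.exists_mul_mem_of_index_three hN heN) hord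
  have hψe : ψ e = e ^ 2 * c := monoidHomOfForallMemZpowers_apply_gen _ _
  let φ : G →* G := invMonoidHom * ψ.comp (QuotientGroup.mk' N)
  have hφ : ∀ g : G, φ g = g⁻¹ * ψ g := fun g => rfl
  have hφn : ∀ n ∈ N, φ n = n⁻¹ := by
    intro n hn
    rw [hφ, (QuotientGroup.eq_one_iff n).2 hn, map_one, mul_one]
  have hφe : φ e = e * c := by
    rw [hφ, hψe, sq, mul_assoc, inv_mul_cancel_left]
  have hφN : ∀ g, φ g * g⁻¹ ∈ N := by
    intro g
    obtain ⟨n, hn, rfl | rfl | rfl⟩ := N.exists_eq_pow_mul_of_index_three hN heN g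
    · rw [hφn _ hn]
      exact N.mul_mem (N.inv_mem hn) (N.inv_mem hn)
    · rw [map_mul, hφn _ hn, hφe]
      have : e * c * n⁻¹ * (e * n)⁻¹ = c * (n⁻¹ * n⁻¹) := by
        rw [mul_inv]
        rw [show e * c * n⁻¹ * (e⁻¹ * n⁻¹) = (e * e⁻¹) * (c * (n⁻¹ * n⁻¹)) by ac_rfl,
          mul_inv_cancel, one_mul]
      rw [this]
      exact N.mul_mem hc (N.mul_mem (N.inv_mem hn) (N.inv_mem hn))
    · rw [map_mul, map_pow, hφn _ hn, hφe, mul_pow]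
      have : e ^ 2 * c ^ 2 * n⁻¹ * (e ^ 2 * n)⁻¹ = c ^ 2 * (n⁻¹ * n⁻¹) := by
        rw [mul_inv]
        rw [show e ^ 2 * c ^ 2 * n⁻¹ * ((e ^ 2)⁻¹ * n⁻¹) =
          (e ^ 2 * (e ^ 2)⁻¹) * (c ^ 2 * (n⁻¹ * n⁻¹)) by ac_rfl, mul_inv_cancel, one_mul]
      rw [this]
      exact N.mul_mem (N.pow_mem hc 2) (N.mul_mem (N.inv_mem hn) (N.inv_mem hn))
  have hφinj : Function.Injective φ := by
    rw [injective_iff_map_eq_one]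
    intro g hg
    have h1 := hφN g
    rw [hg, one_mul, inv_mem_iff] at h1
    rw [hφn g h1, inv_eq_one] at hg
    exact hg
  have hTφ : ∀ g : G, Γ.Adj v (g • v) ↔ Γ.Adj v (φ g • v) := by
    intro g
    obtain ⟨n, hn, rfl | rfl | rfl⟩ := N.exists_eq_pow_mul_of_index_three hN heN g
    · rw [hφn _ hn]
      exact hTsymm g
    · rw [map_mul, hφn _ hn, hφe, hrefl n hn, mul_assoc]
    · rw [map_mul, map_pow, hφn _ hn, hφe, hTsymm]
      have e1 : (e ^ 2 * n)⁻¹ = e * n⁻¹ := by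
        rw [mul_inv, inv_eq_of_mul_eq_one_left (b := e ^ 2) (a := e) (by rw [← pow_succ', he])]
      have e2 : ((e * c) ^ 2 * n⁻¹)⁻¹ = e * (c * n⁻¹⁻¹) := by
        rw [mul_pow, mul_inv, mul_inv,
          inv_eq_of_mul_eq_one_left (b := e ^ 2) (a := e) (by rw [← pow_succ', he]),
          inv_eq_of_mul_eq_one_left (b := c ^ 2) (a := c) (by rw [← pow_succ', hc3]), mul_assoc]
      rw [hTsymm ((e * c) ^ 2 * n⁻¹), e1, e2]
      exact hrefl _ (N.inv_mem hn)
  obtain ⟨a, ha⟩ := h.exists_twist (fun _ : Unit => v) (fun _ _ _ _ => rfl) φ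
    (Finite.surjective_of_injective hφinj)
    (fun _ g hg => by
      rw [hφn g (hvN hg)]
      exact inv_mem hg) (fun _ => 1)
    (fun _ _ g => by
      rw [one_smul, one_smul]
      exact hTφ g)
    (fun y hy _ g => by
      rw [one_smul]
      have := h.adj_iff_of_mem_sup (h2 y (fun ⟨k, hk⟩ => hy () k hk) _ (hφN g)) g
      rw [← this, smul_smul, inv_mul_cancel_right])
  intro n hn
  have h1 := ha () 1
  have h3 := ha () n
  simp only [one_smul, map_one] at h1 h3
  rw [smul_comm, h1, hφn n hn] at h3
  rw [sq, mul_smul, h3, smul_inv_smul]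

theorem index_ne_nine [Finite V] [Finite G] (h : IsFullAut Γ G)
    (hG : Nat.card G = 18) (hexp : ∀ g : G, g ^ 6 = 1) (hlt : Nat.card V ≤ 18) (v : V) :
    (stabilizer G v).index ≠ 9 := by
  intro hv
  have hidx := h.index_eq_of_card_eq_eighteen hG hexp hlt
  have hle : ∀ u v : V, 3 ∣ (stabilizer G u ⊔ stabilizer G v).index →
      3 ∣ (stabilizer G u).index ∧ 3 ∣ (stabilizer G v).index :=
    fun u v huv => ⟨huv.trans (Subgroup.index_dvd_of_le le_sup_left),
      huv.trans (Subgroup.index_dvd_of_le le_sup_right)⟩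
  obtain ⟨t, -, ht⟩ := (⊤ : Subgroup G).exists_orderOf_eq_of_dvd_card Nat.prime_two
    (by rw [Subgroup.card_top, hG]; decide)
  obtain ⟨x, -, hx⟩ := h.exists_prime_dvd_index Nat.prime_two ht
  have hx0 := (stabilizer G x).index_ne_zero_of_finite
  have hxv : x ∉ orbit G v := notMem_orbit_of_index_ne (by omega)
  have h9 : ∀ w, w ∉ orbit G v → (stabilizer G w).index ≠ 9 := by
    intro w hw iw
    have hxw : x ∉ orbit G w := notMem_orbit_of_index_ne (by omega)
    have hsum := sum_index_le (G := G) [v, w, x] (by simp [*])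
    simp at hsum
    omega
  obtain ⟨w, hw, hvw⟩ := h.exists_three_dvd_index (v := v) hexp (by rw [hv]; decide)
  have hiw := (hle _ _ hvw).2
  have hw9 := h9 w hw
  have iw := hidx w
  have hgcd : ∀ y, y ∉ orbit G v → (stabilizer G v ⊔ stabilizer G y).index ∣ 3 := by
    intro y hy
    have h1 := index_sup_dvd_gcd (G := G) v y
    have h2 := h9 y hy
    rw [hv] at h1
    rcases hidx y with e | e | e | e | e <;> rw [e] at h1
    · exact h1.trans (by decide)
    · exact h1.trans (by decide)
    · exact h1.trans (by decide)
    · exact h1.trans (by decide)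
    · exact (h2 e).elim
  have jw := Nat.dvd_antisymm (hgcd w hw) hvw
  obtain ⟨u, huv, huw, hu⟩ := h.exists_three_dvd_index_of_pair hexp hw jw
  have hiu := hu.elim (fun hu => (hle _ _ hu).2) fun hu => (hle _ _ hu).2
  have hu9 := h9 u huv
  have iu := hidx u
  have hsum := sum_index_le (G := G) [v, w, u] (by simp [*])
  simp at hsum
  have hother : ∀ y, y ∉ orbit G v → y ∉ orbit G w → y ∉ orbit G u →
      ¬ 3 ∣ (stabilizer G y).index := by
    intro y h1 h2 h3 h4
    have h0 := (stabilizer G y).index_ne_zero_of_finite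
    have hsum := sum_index_le (G := G) [v, w, u, y] (by simp [*])
    simp at hsum
    have hxw : x ∉ orbit G w := notMem_orbit_of_index_ne (by omega)
    have hxu : x ∉ orbit G u := notMem_orbit_of_index_ne (by omega)
    have hxy : x ∉ orbit G y := notMem_orbit_of_index_ne (by omega)
    have hsum := sum_index_le (G := G) [v, w, u, y, x] (by simp [*])
    simp at hsum
    omega
  have hsq : ∀ H : Subgroup G, ¬ 3 ∣ H.index → ∀ g : G, g ^ 2 ∈ H := fun H hH =>
    Subgroup.sq_mem_of_gcd_index_dvd_two _ hexp (by
      rw [show 6 = 2 * 3 from rfl, Nat.Coprime.gcd_mul_right_cancel 2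
        ((Nat.Prime.coprime_iff_not_dvd Nat.prime_three).2 hH)]
      exact Nat.gcd_dvd_left _ _)
  obtain ⟨g₀, hg₀⟩ := (stabilizer G v).exists_sq_notMem_of_prime_dvd_index Nat.prime_three
    (by decide) (by rw [hv]; decide)
  by_cases hwu : 3 ∣ (stabilizer G w ⊔ stabilizer G u).index
  swap
  · have ju := hgcd u huv
    refine hg₀ (h.sq_smul_eq_of_three hw huv huw jw (Nat.le_of_dvd (by norm_num) ju)
      (Odd.of_dvd_nat (by decide) ju) (hsq _ hwu) (fun y h1 h2 h3 g => ?_) g₀)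
    have h4 := hother y h1 h2 h3
    exact ⟨hsq _ (fun hd => h4 (hle _ _ hd).2) g, hsq _ (fun hd => h4 (hle _ _ hd).2) g,
      hsq _ (fun hd => h4 (hle _ _ hd).2) g⟩
  have hcard : ∀ K : Subgroup G, Nat.card K * K.index = 18 := fun K => hG ▸ K.card_mul_index
  have cw := hcard (stabilizer G w)
  have cu := hcard (stabilizer G u)
  have hw3 : 3 ∣ Nat.card (stabilizer G w) := by
    rcases iw with e | e | e | e | e <;> rw [e] at cw <;> omega
  have hu3 : 3 ∣ Nat.card (stabilizer G u) := by
    rcases iu with e | e | e | e | e <;> rw [e] at cu <;> omega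
  obtain ⟨s, hsw, hs⟩ := (stabilizer G w).exists_orderOf_eq_of_dvd_card Nat.prime_three hw3
  have hsu := Subgroup.mem_of_three_dvd_index_sup hG _ _ hs hsw hu3 hwu
  have hcube : ∀ g : G, g ^ 3 ∈ stabilizer G v := fun g =>
    Subgroup.mem_of_pow_eq_one_of_coprime_index (n := 2) _ (by rw [← pow_mul]; exact hexp g)
      (by rw [hv]; decide)
  have hfour : ∀ K : Subgroup G, 3 ∣ K.index → s ∈ K → ∀ g ∈ K, g ^ 4 ∈ Subgroup.zpowers s := by
    intro K hK hsK g hg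
    by_contra hcon
    have ho : orderOf (g ^ 4) = 3 := by
      refine ((Nat.dvd_prime Nat.prime_three).1 (orderOf_dvd_of_pow_eq_one ?_)).resolve_left ?_
      · rw [← pow_mul, show 4 * 3 = 6 * 2 from rfl, pow_mul, hexp, one_pow]
      · intro e
        rw [orderOf_eq_one_iff] at e
        exact hcon (e ▸ Subgroup.one_mem _)
    have h9 := K.sq_dvd_card_of_notMem_zpowers Nat.prime_three ho hs (K.pow_mem hg 4) hsK hcon
    have := mul_dvd_mul h9 hK
    rw [Subgroup.card_mul_index, hG] at this
    omega
  have hsub : ∀ K L : Subgroup G, 3 ∣ K.index → s ∈ K → s ∈ L →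
      K ≤ stabilizer G v ⊔ L := by
    intro K L hK hsK hsL k hk
    have h1 : k = (k ^ 3)⁻¹ * k ^ 4 := by rw [pow_succ k 3, inv_mul_cancel_left]
    rw [h1]
    exact Subgroup.mul_mem_sup (inv_mem (hcube k))
      ((Subgroup.zpowers_le.2 hsL) (hfour K hK hsK k hk))
  have hN : stabilizer G v ⊔ stabilizer G u = stabilizer G v ⊔ stabilizer G w :=
    le_antisymm (sup_le le_sup_left (hsub _ _ hiu hsu hsw))
      (sup_le le_sup_left (hsub _ _ hiw hsw hsu))
  obtain ⟨e, he⟩ := (stabilizer G v ⊔ stabilizer G w).exists_sq_notMem_of_prime_dvd_index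
    Nat.prime_three (by decide) hvw
  have hrel : (stabilizer G v).relIndex (stabilizer G v ⊔ stabilizer G w) ≤ 5 := by
    have := Subgroup.relIndex_mul_index
      (le_sup_left : stabilizer G v ≤ stabilizer G v ⊔ stabilizer G w)
    rw [hv, jw] at this
    omega
  have key := h.sq_smul_eq_of_index_three _ jw le_sup_left hrel he
    (by rw [← pow_mul]; exact hexp e) (fun n _ => hcube n)
    (fun n _ => by rw [← pow_mul, show 4 * 3 = 6 * 2 from rfl, pow_mul, hexp, one_pow])
    (fun y hy n hn => ?_) s (Subgroup.mem_sup_right hsw)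
  · have hs2 : s ^ 2 ∈ stabilizer G v := key
    have h1 := Subgroup.card_dvd_of_le (Subgroup.zpowers_le.2 hs2)
    have h2 := hcard (stabilizer G v)
    rw [Nat.card_zpowers, orderOf_pow, hs] at h1
    rw [hv] at h2
    have h3 : Nat.card (stabilizer G v) = 2 := by omega
    rw [h3] at h1
    revert h1
    decide
  · rw [sup_comm]
    by_cases hyw : y ∈ orbit G w
    · rwa [stabilizer_eq_of_mem_orbit hyw]
    by_cases hyu : y ∈ orbit G u
    · rwa [stabilizer_eq_of_mem_orbit hyu, hN]
    have h3 := hother y hy hyw hyu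
    have h1 : (stabilizer G v ⊔ stabilizer G y).index = 1 := by
      refine ((Nat.dvd_prime Nat.prime_three).1 (hgcd y hy)).resolve_right fun e => h3 ?_
      exact (hle _ _ e.symm.dvd).2
    rw [Subgroup.index_eq_one.1 h1]
    trivial

theorem lt_card_of_card_eq_eighteen [Finite V] [Finite G] (h : IsFullAut Γ G)
    (hG : Nat.card G = 18) (hexp : ∀ g : G, g ^ 6 = 1) : 18 < Nat.card V := by
  by_contra! hlt
  exact hlt.not_gt (h.lt_card_of_forall_index_ne_nine hG hexp (h.index_ne_nine hG hexp hlt))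

end IsFullAut

/-- The vertex action of a group identified with the automorphism group of a graph. -/
abbrev MulEquiv.graphAction {V : Type*} {Γ : SimpleGraph V} {G : Type*} [Group G]
    (e : (Γ ≃g Γ) ≃* G) : MulAction G V where
  smul g v := e.symm g v
  one_smul v := by
    change e.symm 1 v = v
    rw [map_one]
    rfl
  mul_smul a b v := by
    change e.symm (a * b) v = e.symm a (e.symm b v)
    rw [map_mul]
    rfl

theorem MulEquiv.isFullAut {V : Type*} {Γ : SimpleGraph V} {G : Type*} [CommGroup G]
    (e : (Γ ≃g Γ) ≃* G) : @IsFullAut V Γ G _ e.graphAction := by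
  let := e.graphAction
  have hsmul : ∀ (g : G) (v : V), g • v = e.symm g v := fun _ _ => rfl
  refine ⟨fun g u v => (e.symm g).map_adj_iff, fun φ => ⟨e φ, fun v => ?_⟩, fun g hg => ?_⟩
  · rw [hsmul, e.symm_apply_apply]
  · rw [← map_eq_one_iff e.symm e.symm.injective]
    ext v
    exact hg v

theorem ExcCyclic.card_lt {G : Type*} [CommGroup G] [Finite G] (hG : ExcCyclic G) {n : ℕ}
    {Γ : SimpleGraph (Fin n)} (e : (Γ ≃g Γ) ≃* G) : Nat.card G < n := by
  let := e.graphAction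
  obtain ⟨hc, h2, h⟩ := hG
  rw [← Nat.card_fin n]
  rcases h with ⟨p, k, hp, hk, h⟩ | ⟨p, hp, h⟩
  · exact e.isFullAut.lt_card_of_isCyclic_prime_pow hp hk h h2
  · rcases eq_or_ne p 2 with rfl | hp2
    · exact e.isFullAut.lt_card_of_isCyclic_prime_pow Nat.prime_two (k := 2) two_pos h h2
    · exact e.isFullAut.lt_card_of_isCyclic_two_mul_prime hp hp2 h

theorem ExcTenAbelian.card_lt {G : Type*} [CommGroup G] [Finite G] (hG : ExcTenAbelian G) {n : ℕ}
    {Γ : SimpleGraph (Fin n)} (e : (Γ ≃g Γ) ≃* G) : Nat.card G < n := by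
  rcases hG with ⟨⟨f⟩⟩ | ⟨⟨f⟩⟩ | ⟨⟨f⟩⟩ | ⟨⟨f⟩⟩ | ⟨⟨f⟩⟩ | ⟨⟨f⟩⟩ | ⟨⟨f⟩⟩ | ⟨⟨f⟩⟩ | ⟨⟨f⟩⟩ | ⟨⟨f⟩⟩ <;>
    rw [Nat.card_congr f.toEquiv] <;> let := (e.trans f).graphAction <;>
    have h := (e.trans f).isFullAut <;> conv_rhs => rw [← Nat.card_fin n]
  · rw [Nat.card_eq_fintype_card, Fintype.card_multiplicative, ZMod.card]
    exact h.lt_card_of_isCyclic_twelve (by simp)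
  · rw [Nat.card_eq_fintype_card, Fintype.card_multiplicative, ZMod.card]
    exact h.lt_card_of_isCyclic_fifteen (by simp)
  · rw [Nat.card_eq_fintype_card, Fintype.card_multiplicative, ZMod.card]
    exact h.lt_card_of_isCyclic_twenty (by simp)
  · rw [Nat.card_eq_fintype_card, Fintype.card_multiplicative, ZMod.card]
    exact h.lt_card_of_isCyclic_twentyOne (by simp)
  · simpa using h.lt_card_of_two_four
  · exact h.lt_card_of_card_eq_prime_sq (p := 3) (Or.inl rfl) (by simp)
  · simpa using h.lt_card_of_four_four
  · exact h.lt_card_of_card_eq_prime_sq (p := 5) (Or.inr rfl) (by simp)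
  · simpa using h.lt_card_of_card_eq_twelve (by simp) (by decide)
  · simpa using h.lt_card_of_card_eq_eighteen (by simp) (by decide)

open scoped SimpleGraph

/-- `HasGraph G N` means that some simple graph on `N` vertices has automorphism group `G`. -/
def HasGraph (G : Type*) [Group G] (N : ℕ) : Prop :=
  ∃ Γ : SimpleGraph (Fin N), Nonempty ((Γ ≃g Γ) ≃* G)

/-- Isomorphic graphs have isomorphic automorphism groups. -/
def SimpleGraph.Iso.autCongr {V W : Type*} {Γ : SimpleGraph V} {Δ : SimpleGraph W} (i : Γ ≃g Δ) :
    (Γ ≃g Γ) ≃* (Δ ≃g Δ) where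
  toFun φ := (i.symm.trans φ).trans i
  invFun φ := (i.trans φ).trans i.symm
  left_inv φ := by ext v; simp
  right_inv φ := by ext v; simp
  map_mul' φ ψ := by
    ext v
    simp [RelIso.mul_apply]

/-- A graph and its complement have the same automorphisms. -/
def SimpleGraph.autCompl {V : Type*} (Γ : SimpleGraph V) : (Γ ≃g Γ) ≃* (Γᶜ ≃g Γᶜ) where
  toFun φ := ⟨φ.toEquiv, by simp +contextual [SimpleGraph.compl_adj, φ.map_adj_iff]⟩
  invFun φ := ⟨φ.toEquiv, by
    intro u v
    have h := φ.map_rel_iff (a := u) (b := v)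
    simp only [SimpleGraph.compl_adj] at h
    rcases eq_or_ne u v with rfl | huv
    · simp
    · change Γ.Adj (φ u) (φ v) ↔ Γ.Adj u v
      have : φ u ≠ φ v := φ.toEquiv.injective.ne huv
      tauto⟩
  left_inv φ := by ext v; rfl
  right_inv φ := by ext v; rfl
  map_mul' φ ψ := by ext v; rfl

theorem HasGraph.of_graph {V : Type*} [Finite V] (Γ : SimpleGraph V) {G : Type*} [Group G]
    (e : (Γ ≃g Γ) ≃* G) {N : ℕ} (hN : Nat.card V = N) : HasGraph G N := by
  subst hN
  exact ⟨_, ⟨(SimpleGraph.Iso.map (Finite.equivFin V) Γ).autCongr.symm.trans e⟩⟩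

theorem HasGraph.congr {G H : Type*} [Group G] [Group H] (e : G ≃* H) {N : ℕ}
    (h : HasGraph G N) : HasGraph H N :=
  let ⟨Γ, ⟨f⟩⟩ := h
  ⟨Γ, ⟨f.trans e⟩⟩

theorem HasGraph.graphAlpha_le {G : Type*} [Group G] {N : ℕ} (h : HasGraph G N) :
    graphAlpha G ≤ N :=
  Nat.sInf_le h

theorem HasGraph.exists_connected {G : Type*} [Group G] {N : ℕ} (h : HasGraph G N) (hN : N ≠ 0) :
    ∃ Γ : SimpleGraph (Fin N), Γ.Connected ∧ Nonempty ((Γ ≃g Γ) ≃* G) := by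
  obtain ⟨Γ, ⟨e⟩⟩ := h
  have := NeZero.mk hN
  rcases Γ.connected_or_connected_compl with hc | hc
  · exact ⟨Γ, hc, ⟨e⟩⟩
  · exact ⟨Γᶜ, hc, ⟨Γ.autCompl.symm.trans e⟩⟩

section Sum

variable {V W : Type*} {Γ : SimpleGraph V} {Δ : SimpleGraph W}

theorem SimpleGraph.Reachable.isLeft_eq {a b : V ⊕ W} (h : (Γ ⊕g Δ).Reachable a b) :
    a.isLeft = b.isLeft := by
  obtain ⟨p⟩ := h
  induction p with
  | nil => rfl
  | @cons u v w h _ ih =>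
    rw [← ih]
    rcases u with u | u <;> rcases v with v | v <;> simp_all

theorem SimpleGraph.Connected.isLeft_eq_inl (hΓ : Γ.Connected) (φ : Γ ⊕g Δ ≃g Γ ⊕g Δ) (u v : V) :
    (φ (.inl u)).isLeft = (φ (.inl v)).isLeft :=
  (((hΓ u v).map SimpleGraph.Embedding.sumInl.toHom).map φ.toHom).isLeft_eq

theorem SimpleGraph.Connected.isLeft_eq_inr (hΔ : Δ.Connected) (φ : Γ ⊕g Δ ≃g Γ ⊕g Δ) (u v : W) :
    (φ (.inr u)).isLeft = (φ (.inr v)).isLeft :=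
  (((hΔ u v).map SimpleGraph.Embedding.sumInr.toHom).map φ.toHom).isLeft_eq

theorem SimpleGraph.Connected.isLeft_of_isEmpty_iso (hΓ : Γ.Connected) (hΔ : Δ.Connected)
    (hi : IsEmpty (Γ ≃g Δ)) (φ : Γ ⊕g Δ ≃g Γ ⊕g Δ) (v : V) : (φ (.inl v)).isLeft := by
  by_contra hv
  have hr : ∀ u, ∃ w, φ (.inl u) = .inr w := fun u => by
    rw [hΓ.isLeft_eq_inl φ v u] at hv
    simpa [Sum.isRight_iff] using hv
  choose f hf using hr
  have hl : ∀ w, ∃ u, φ.symm (.inr w) = .inl u := fun w => by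
    refine Sum.isLeft_iff.1 ?_
    rw [hΔ.isLeft_eq_inr φ.symm w (f v), ← hf v, φ.symm_apply_apply, Sum.isLeft_inl]
  choose g hg using hl
  refine hi.false ⟨⟨f, g, fun u => ?_, fun w => ?_⟩, fun {a b} => ?_⟩
  · apply Sum.inl_injective (β := W)
    rw [← hg, ← hf, φ.symm_apply_apply]
  · apply Sum.inr_injective (α := V)
    rw [← hf, ← hg, φ.apply_symm_apply]
  · change Δ.Adj (f a) (f b) ↔ Γ.Adj a b
    rw [← SimpleGraph.sum_adj_inr (G := Γ), ← hf, ← hf, φ.map_adj_iff, SimpleGraph.sum_adj_inl]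

/-- The automorphisms of two connected graphs act on their disjoint sum. -/
def SimpleGraph.autProdHom (Γ : SimpleGraph V) (Δ : SimpleGraph W) :
    (Γ ≃g Γ) × (Δ ≃g Δ) →* (Γ ⊕g Δ ≃g Γ ⊕g Δ) where
  toFun φ := φ.1.sumCongr φ.2
  map_one' := by
    ext (v | v) <;> rfl
  map_mul' φ ψ := by
    ext (v | v) <;> rfl

theorem SimpleGraph.autProdHom_bijective [Finite V] [Finite W] (hΓ : Γ.Connected)
    (hΔ : Δ.Connected) (hi : IsEmpty (Γ ≃g Δ)) : Function.Bijective (Γ.autProdHom Δ) := by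
  constructor
  · rintro ⟨φ, ψ⟩ ⟨φ', ψ'⟩ h
    ext v
    · exact Sum.inl_injective (DFunLike.congr_fun h (.inl v))
    · exact Sum.inr_injective (DFunLike.congr_fun h (.inr v))
  · intro φ
    obtain ⟨⟨f, g⟩, hfg⟩ := Equiv.Perm.mem_sumCongrHom_range_of_perm_mapsTo_inl
      (σ := φ.toEquiv) (by
        rintro _ ⟨v, rfl⟩
        obtain ⟨u, hu⟩ := Sum.isLeft_iff.1 (hΓ.isLeft_of_isEmpty_iso hΔ hi φ v)
        exact ⟨u, hu.symm⟩)
    have h1 : ∀ v, φ (.inl v) = .inl (f v) := fun v => (DFunLike.congr_fun hfg (.inl v)).symm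
    have h2 : ∀ v, φ (.inr v) = .inr (g v) := fun v => (DFunLike.congr_fun hfg (.inr v)).symm
    refine ⟨(⟨f, fun {a b} => ?_⟩, ⟨g, fun {a b} => ?_⟩), ?_⟩
    · rw [← SimpleGraph.sum_adj_inl (H := Δ), ← h1, ← h1, φ.map_adj_iff, SimpleGraph.sum_adj_inl]
    · rw [← SimpleGraph.sum_adj_inr (G := Γ), ← h2, ← h2, φ.map_adj_iff, SimpleGraph.sum_adj_inr]
    · ext (v | v)
      · exact (h1 v).symm
      · exact (h2 v).symm

end Sum

theorem HasGraph.prod_of_connected {V W : Type*} [Finite V] [Finite W] {Γ : SimpleGraph V}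
    {Δ : SimpleGraph W} {G H : Type*} [Group G] [Group H] (hΓ : Γ.Connected) (hΔ : Δ.Connected)
    (hi : IsEmpty (Γ ≃g Δ)) (e : (Γ ≃g Γ) ≃* G) (f : (Δ ≃g Δ) ≃* H) {N : ℕ}
    (hN : Nat.card V + Nat.card W = N) : HasGraph (G × H) N :=
  .of_graph (Γ ⊕g Δ)
    ((MulEquiv.ofBijective _ (SimpleGraph.autProdHom_bijective hΓ hΔ hi)).symm.trans
      (e.prodCongr f)) (by rw [Nat.card_sum, hN])

theorem HasGraph.prod {G H : Type*} [Group G] [Group H] {M N : ℕ} (hG : HasGraph G M)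
    (hH : HasGraph H N) (hM : M ≠ 0) (hN : N ≠ 0) (h : M ≠ N) : HasGraph (G × H) (M + N) := by
  obtain ⟨Γ, hΓ, ⟨e⟩⟩ := hG.exists_connected hM
  obtain ⟨Δ, hΔ, ⟨f⟩⟩ := hH.exists_connected hN
  refine .prod_of_connected hΓ hΔ ⟨fun i => h ?_⟩ e f (by simp)
  simpa using Nat.card_congr i.toEquiv

theorem HasGraph.of_subsingleton {G : Type*} [Group G] [Subsingleton G] {N : ℕ} (hN : N ≤ 1) :
    HasGraph G N := by
  have : Subsingleton (Fin N) := Fin.subsingleton_iff_le_one.2 hN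
  exact ⟨⊥, ⟨⟨⟨fun _ => 1, fun _ => 1, fun φ => by
    ext v; exact congrArg Fin.val (Subsingleton.elim _ _),
    fun g => Subsingleton.elim _ _⟩, fun _ _ => Subsingleton.elim _ _⟩⟩⟩

theorem HasGraph.succ {G : Type*} [Group G] {N : ℕ} (h : HasGraph G N) (hN : 2 ≤ N) :
    HasGraph G (N + 1) :=
  (h.prod (HasGraph.of_subsingleton (G := Unit) le_rfl) (by omega) one_ne_zero (by omega)).congr
    MulEquiv.prodUnique

theorem HasGraph.mono {G : Type*} [Group G] {M N : ℕ} (h : HasGraph G M) (hM : 2 ≤ M)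
    (hMN : M ≤ N) : HasGraph G N := by
  induction N, hMN using Nat.le_induction with
  | base => exact h
  | succ N hN ih => exact ih.succ (hM.trans hN)

section CycleGraph

variable {n : ℕ} {W : Type*}

/-- The cycle on `ZMod n`, together with further vertices `W` attached to it along `R` and
to each other along `S`. -/
def cycleExtension (R : ZMod n → W → Prop) (S : W → W → Prop) : SimpleGraph (ZMod n ⊕ W) where
  Adj
    | .inl x, .inl y => x ≠ y ∧ (y = x + 1 ∨ x = y + 1)
    | .inl x, .inr w => R x w
    | .inr w, .inl x => R x w
    | .inr v, .inr w => v ≠ w ∧ (S v w ∨ S w v)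
  symm := ⟨by
    rintro (x | v) (y | w)
    · exact fun h => ⟨h.1.symm, h.2.symm⟩
    · exact id
    · exact id
    · exact fun h => ⟨h.1.symm, h.2.symm⟩⟩
  loopless := ⟨by
    rintro (x | v)
    · exact fun h => h.1 rfl
    · exact fun h => h.1 rfl⟩

instance [DecidableEq W] (R : ZMod n → W → Prop) (S : W → W → Prop) [DecidableRel R]
    [DecidableRel S] : DecidableRel (cycleExtension R S).Adj
  | .inl x, .inl y => inferInstanceAs (Decidable (x ≠ y ∧ (y = x + 1 ∨ x = y + 1)))
  | .inl x, .inr w => inferInstanceAs (Decidable (R x w))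
  | .inr w, .inl x => inferInstanceAs (Decidable (R x w))
  | .inr v, .inr w => inferInstanceAs (Decidable (v ≠ w ∧ (S v w ∨ S w v)))

variable {R : ZMod n → W → Prop} {S : W → W → Prop}

theorem cycleExtension_adj_inl (hn : 3 ≤ n) {x y : ZMod n} :
    (cycleExtension R S).Adj (.inl x) (.inl y) ↔ y = x + 1 ∨ x = y + 1 := by
  have : Fact (1 < n) := ⟨by omega⟩
  refine ⟨fun h => h.2, fun h => ⟨?_, h⟩⟩
  rintro rfl
  simp at h

/-- The rotation of the cycle, combined with a compatible permutation of the other vertices. -/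
def cycleExtension.rotate (σ : Equiv.Perm W) (hR : ∀ x w, R (x + 1) (σ w) ↔ R x w)
    (hS : ∀ v w, S (σ v) (σ w) ↔ S v w) : cycleExtension R S ≃g cycleExtension R S where
  toEquiv := Equiv.sumCongr (Equiv.addRight 1) σ
  map_rel_iff' := by
    rintro (x | v) (y | w)
    · simp [cycleExtension]
    · exact hR x w
    · exact hR y v
    · simp [cycleExtension, hS]

/-- A permutation of `ZMod n` preserving the cycle is a rotation or a reflection. -/
theorem ZMod.eq_add_or_eq_sub_of_cycle (hn : 3 ≤ n) {f : ZMod n → ZMod n}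
    (hf : Function.Injective f)
    (h : ∀ x, f (x + 1) = f x + 1 ∨ f x = f (x + 1) + 1) :
    (∀ x, f x = x + f 0) ∨ ∀ x, f x = -x + f 0 := by
  have := NeZero.of_pos (show 0 < n by omega)
  have h2 : (2 : ZMod n) ≠ 0 := by
    intro h
    have := (ZMod.natCast_eq_zero_iff 2 n).1 (by exact_mod_cast h)
    exact absurd (Nat.le_of_dvd two_pos this) (by omega)
  have hne : ∀ x, f (x + 1 + 1) ≠ f x := fun x hx => h2 (by linear_combination hf hx)
  have key : ∀ ε : ZMod n, f 1 = f 0 + ε → (ε = 1 ∨ ε = -1) → ∀ x, f x = ε * x + f 0 := by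
    intro ε h1 hε
    have hs : ∀ k : ℕ, f (k + 1 : ZMod n) = f k + ε := by
      intro k
      induction k with
      | zero => simpa using h1
      | succ k ih =>
        push_cast
        have hk := hne k
        rcases h (k + 1 : ZMod n) with h' | h' <;> rcases hε with rfl | rfl
        · exact h'
        · exact absurd (by rw [h', ih]; ring) hk
        · exact absurd (by linear_combination -h' + ih) hk
        · linear_combination -h'
    intro x
    obtain ⟨k, rfl⟩ := ZMod.natCast_zmod_surjective x
    induction k with
    | zero => simp
    | succ k ih =>
      push_cast
      rw [hs, ih]
      ring
  rcases h 0 with h0 | h0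
  · left
    simpa using key 1 (by simpa using h0) (.inl rfl)
  · right
    simpa using key (-1) (by simp only [zero_add] at h0; linear_combination -h0) (.inr rfl)

theorem nonempty_aut_cycleExtension (hn : 3 ≤ n) (σ : Equiv.Perm W)
    (hR : ∀ x w, R (x + 1) (σ w) ↔ R x w) (hS : ∀ v w, S (σ v) (σ w) ↔ S v w)
    (hd : ∀ w, Nat.card ((cycleExtension R S).neighborSet (.inr w)) ≠
      Nat.card ((cycleExtension R S).neighborSet (.inl 0)))
    (hinj : ∀ v w, (∀ x, R x v ↔ R x w) → v = w)
    (hrefl : ∃ v w, ∀ v' w', (∀ x, R (-x) v' ↔ R x v) → (∀ x, R (-x) w' ↔ R x w) →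
      ¬ ((cycleExtension R S).Adj (.inr v') (.inr w') ↔
        (cycleExtension R S).Adj (.inr v) (.inr w))) :
    Nonempty ((cycleExtension R S ≃g cycleExtension R S) ≃* Cyc n) := by
  have := NeZero.of_pos (show 0 < n by omega)
  set Γ := cycleExtension R S with hΓ
  set τ : Γ ≃g Γ := cycleExtension.rotate σ hR hS
  have hτ : ∀ x, τ (.inl x) = .inl (x + 1) := fun x => rfl
  have hτk : ∀ (k : ℕ) x, (τ ^ k) (.inl x) = .inl (x + k) := by
    intro k
    induction k with
    | zero => intro x; simp [RelIso.one_apply]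
    | succ k ih =>
      intro x
      rw [pow_succ, RelIso.mul_apply, hτ, ih]
      push_cast
      congr 1
      ring
  have hdeg : ∀ (φ : Γ ≃g Γ) v, Nat.card (Γ.neighborSet (φ v)) = Nat.card (Γ.neighborSet v) :=
    fun φ v => (Nat.card_congr (φ.mapNeighborSet v)).symm
  have hinl : ∀ (φ : Γ ≃g Γ) x, ∃ y, φ (.inl x) = .inl y := by
    intro φ x
    obtain ⟨k, rfl⟩ := ZMod.natCast_zmod_surjective x
    rcases h : φ (.inl (k : ZMod n)) with y | w
    · exact ⟨y, rfl⟩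
    · refine absurd ?_ (hd w)
      rw [← h, hdeg, ← zero_add (k : ZMod n), ← hτk, hdeg]
  have hinr : ∀ (φ : Γ ≃g Γ) w, ∃ v, φ (.inr w) = .inr v := by
    intro φ w
    rcases h : φ (.inr w) with y | v
    · obtain ⟨x, hx⟩ := hinl φ.symm y
      rw [← h, φ.symm_apply_apply] at hx
      cases hx
    · exact ⟨v, rfl⟩
  have hone : ∀ φ : Γ ≃g Γ, (∀ x, φ (.inl x) = .inl x) → φ = 1 := by
    intro φ hφ
    ext (x | w)
    · rw [hφ]; rfl
    · obtain ⟨v, hv⟩ := hinr φ w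
      rw [hv, RelIso.one_apply, hinj v w fun x => ?_]
      have := φ.map_adj_iff (v := .inl x) (w := .inr w)
      rwa [hv, hφ] at this
  have hneg : ∀ φ : Γ ≃g Γ, ¬ ∀ x, φ (.inl x) = .inl (-x) := by
    intro φ hφ
    obtain ⟨v, w, h⟩ := hrefl
    obtain ⟨v', hv⟩ := hinr φ v
    obtain ⟨w', hw⟩ := hinr φ w
    refine h v' w' (fun x => ?_) (fun x => ?_) ?_
    · have := φ.map_adj_iff (v := .inl x) (w := .inr v)
      rwa [hv, hφ] at this
    · have := φ.map_adj_iff (v := .inl x) (w := .inr w)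
      rwa [hw, hφ] at this
    · rw [← hv, ← hw, φ.map_adj_iff]
  have hgen : ∀ φ : Γ ≃g Γ, ∃ k : ℕ, τ ^ k = φ := by
    intro φ
    choose f hf using hinl φ
    obtain ⟨k, hk⟩ := ZMod.natCast_zmod_surjective (f 0)
    refine ⟨k, ?_⟩
    have hk' : ∀ x, (τ ^ k)⁻¹ (.inl (x + f 0)) = .inl x := fun x => by
      rw [← hk, ← hτk, ← RelIso.mul_apply, inv_mul_cancel, RelIso.one_apply]
    rw [← inv_mul_eq_one]
    rcases ZMod.eq_add_or_eq_sub_of_cycle (f := f) hn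
      (fun x y h => Sum.inl_injective (φ.injective (by rw [hf, hf, h])))
      (fun x => by
        rw [← cycleExtension_adj_inl (R := R) (S := S) hn, ← hf, ← hf, ← hΓ, φ.map_adj_iff, hΓ,
          cycleExtension_adj_inl hn]
        exact .inl rfl) with h | h
    · exact hone _ fun x => by rw [RelIso.mul_apply, hf, h, hk']
    · exact absurd (fun x => by rw [RelIso.mul_apply, hf, h, hk']) (hneg ((τ ^ k)⁻¹ * φ))
  have hord : orderOf τ = n := by
    refine Nat.dvd_antisymm (orderOf_dvd_of_pow_eq_one (hone _ fun x => ?_)) ?_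
    · rw [hτk]; simp
    · rw [← ZMod.natCast_eq_zero_iff]
      have := hτk (orderOf τ) 0
      rw [pow_orderOf_eq_one, RelIso.one_apply, zero_add] at this
      exact (Sum.inl_injective this).symm
  have hmem : ∀ φ, φ ∈ Subgroup.zpowers τ := fun φ =>
    let ⟨k, hk⟩ := hgen φ
    ⟨k, by simpa using hk⟩
  have : IsCyclic (Γ ≃g Γ) := ⟨⟨τ, hmem⟩⟩
  have hcard : Nat.card (Γ ≃g Γ) = Nat.card (Cyc n) := by
    rw [← orderOf_eq_card_of_forall_mem_zpowers hmem, hord]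
    simp
  exact ⟨mulEquivOfCyclicCardEq hcard⟩

theorem HasGraph.of_cycleExtension [Finite W] (hn : 3 ≤ n)
    (h : Nonempty ((cycleExtension R S ≃g cycleExtension R S) ≃* Cyc n))
    {N : ℕ} (hN : n + Nat.card W = N) : HasGraph (Cyc n) N := by
  have := NeZero.of_pos (show 0 < n by omega)
  obtain ⟨e⟩ := h
  exact .of_graph _ e (by simp [hN])

end CycleGraph

/-- Each vertex of the cycle is joined to its residue in a first copy of `ZMod m`, and to all but
its residue in a second copy. -/
def residueRel (n m : ℕ) (x : ZMod n) (w : ZMod m ⊕ ZMod m) : Bool :=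
  w.elim (fun y => y = (x.cast : ZMod m)) (fun z => z ≠ (x.cast : ZMod m))

/-- Each residue in the first copy of `ZMod m` is joined to its successor in the second copy. -/
def succRel (m : ℕ) (v w : ZMod m ⊕ ZMod m) : Bool :=
  v.elim (fun y => w.elim (fun _ => false) (fun z => z = y + 1)) (fun _ => false)

theorem nonempty_aut_cycleExtension_three :
    Nonempty ((cycleExtension (fun x w => residueRel 3 3 x w) (fun v w => succRel 3 v w) ≃g
      cycleExtension (fun x w => residueRel 3 3 x w) (fun v w => succRel 3 v w)) ≃* Cyc 3) := by
  refine nonempty_aut_cycleExtension (by decide)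
    (Equiv.sumCongr (Equiv.addRight 1) (Equiv.addRight 1)) (by decide) (by decide) ?_
    (by decide) ⟨.inl 0, .inr 1, by decide⟩
  simp only [Nat.card_eq_fintype_card]
  decide

theorem HasGraph.cyc_three : HasGraph (Cyc 3) 9 :=
  .of_cycleExtension (by decide) nonempty_aut_cycleExtension_three (by simp)

theorem SimpleGraph.connected_of_radius_two {V : Type*} (Γ : SimpleGraph V) (v : V)
    (h : ∀ w, v = w ∨ ∃ u, Γ.Adj v u ∧ (u = w ∨ Γ.Adj u w)) : Γ.Connected := by
  refine (SimpleGraph.connected_iff_exists_forall_reachable Γ).2 ⟨v, fun w => ?_⟩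
  rcases h w with rfl | ⟨u, hu, rfl | hw⟩
  · exact .refl _
  · exact hu.reachable
  · exact hu.reachable.trans hw.reachable

theorem HasGraph.cyc_three_prod_cyc_three : HasGraph (Cyc 3 × Cyc 3) 18 := by
  obtain ⟨e⟩ := nonempty_aut_cycleExtension_three
  refine .prod_of_connected (SimpleGraph.connected_of_radius_two _ (.inl 0) (by decide))
    (SimpleGraph.connected_of_radius_two _ (.inl 0) (by decide)) ⟨fun i => ?_⟩ e
    ((SimpleGraph.autCompl _).symm.trans e) (by simp)
  have h := Nat.card_congr (i.mapNeighborSet (.inr (.inl 0)))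
  revert h
  generalize i (.inr (.inl 0)) = v
  revert v
  simp only [Nat.card_eq_fintype_card]
  decide

theorem HasGraph.cyc_five : HasGraph (Cyc 5) 15 := by
  refine .of_cycleExtension (by decide) (nonempty_aut_cycleExtension
    (R := fun x w => residueRel 5 5 x w) (S := fun v w => succRel 5 v w)
    (by decide) (Equiv.sumCongr (Equiv.addRight 1) (Equiv.addRight 1)) (by decide) (by decide) ?_
    (by decide) ⟨.inl 0, .inr 1, by decide⟩) (by simp)
  simp only [Nat.card_eq_fintype_card]
  decide

theorem HasGraph.cyc_nine : HasGraph (Cyc 9) 15 := by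
  refine .of_cycleExtension (by decide) (nonempty_aut_cycleExtension
    (R := fun x w => residueRel 9 3 x w) (S := fun v w => succRel 3 v w)
    (by decide) (Equiv.sumCongr (Equiv.addRight 1) (Equiv.addRight 1)) (by decide) (by decide) ?_
    (by decide) ⟨.inl 0, .inr 1, by decide⟩) (by simp)
  simp only [Nat.card_eq_fintype_card]
  decide

set_option maxRecDepth 4000 in
theorem HasGraph.cyc_twentyFive : HasGraph (Cyc 25) 35 := by
  refine .of_cycleExtension (by decide) (nonempty_aut_cycleExtension
    (R := fun x w => residueRel 25 5 x w) (S := fun v w => succRel 5 v w)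
    (by decide) (Equiv.sumCongr (Equiv.addRight 1) (Equiv.addRight 1)) (by decide) (by decide) ?_
    (by decide) ⟨.inl 0, .inr 1, by decide⟩) (by simp)
  simp only [Nat.card_eq_fintype_card]
  decide

/-- Each vertex of the cycle is joined to its residue and the next one modulo four, and to its
residue modulo two. -/
def dyadicRel (n : ℕ) (x : ZMod n) (w : ZMod 4 ⊕ ZMod 2) : Bool :=
  w.elim (fun y => y = (x.cast : ZMod 4) ∨ y = (x.cast : ZMod 4) + 1)
    (fun z => z = (x.cast : ZMod 2))

/-- Residues modulo four are joined to each other and to their reductions modulo two. -/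
def reductionRel (v w : ZMod 4 ⊕ ZMod 2) : Bool :=
  v.elim (fun y => w.elim (fun _ => true) (fun z => z = (y.cast : ZMod 2))) (fun _ => false)

theorem HasGraph.cyc_four : HasGraph (Cyc 4) 10 := by
  refine .of_cycleExtension (by decide) (nonempty_aut_cycleExtension
    (R := fun x w => dyadicRel 4 x w) (S := fun v w => reductionRel v w)
    (by decide) (Equiv.sumCongr (Equiv.addRight 1) (Equiv.addRight 1)) (by decide) (by decide) ?_
    (by decide) ⟨.inl 0, .inr 0, by decide⟩) (by simp)
  simp only [Nat.card_eq_fintype_card]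
  decide

theorem HasGraph.cyc_eight : HasGraph (Cyc 8) 14 := by
  refine .of_cycleExtension (by decide) (nonempty_aut_cycleExtension
    (R := fun x w => dyadicRel 8 x w) (S := fun v w => reductionRel v w)
    (by decide) (Equiv.sumCongr (Equiv.addRight 1) (Equiv.addRight 1)) (by decide) (by decide) ?_
    (by decide) ⟨.inl 0, .inr 0, by decide⟩) (by simp)
  simp only [Nat.card_eq_fintype_card]
  decide

theorem HasGraph.cyc_of_dvd {n m : ℕ} (hm : 7 ≤ m) (hmn : m ∣ n) (hn : n ≠ 0) :
    HasGraph (Cyc n) (n + m) := by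
  have := NeZero.mk hn
  have := NeZero.of_pos (show 0 < m by omega)
  have hnm := Nat.le_of_dvd (Nat.pos_of_ne_zero hn) hmn
  have hz : ∀ {k : ℕ}, 7 ≤ k → ∀ a : ℤ, a ≠ 0 → a.natAbs < 7 → (a : ZMod k) ≠ 0 := by
    intro k hk a ha ha' h
    have := Int.natAbs_dvd_natAbs.2 ((ZMod.intCast_zmod_eq_zero_iff_dvd a k).1 h)
    have := Nat.le_of_dvd (Int.natAbs_pos.2 ha) this
    simp at this
    omega
  have h1 : (1 : ZMod m) ≠ 0 := by simpa using hz hm 1 (by decide) (by decide)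
  have h2 : (2 : ZMod m) ≠ 0 := by simpa using hz hm 2 (by decide) (by decide)
  have h3 : (3 : ZMod m) ≠ 0 := by simpa using hz hm 3 (by decide) (by decide)
  have h4 : (4 : ZMod m) ≠ 0 := by simpa using hz hm 4 (by decide) (by decide)
  have h5 : (5 : ZMod m) ≠ 0 := by simpa using hz hm 5 (by decide) (by decide)
  have h6 : (6 : ZMod m) ≠ 0 := by simpa using hz hm 6 (by decide) (by decide)
  have hn2 : (2 : ZMod n) ≠ 0 := by simpa using hz (hm.trans hnm) 2 (by decide) (by decide)
  set c : ZMod n →+* ZMod m := ZMod.castHom hmn (ZMod m) with hc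
  have hcs : Function.Surjective c := ZMod.castHom_surjective hmn
  let R : ZMod n → ZMod m → Prop := fun x w => w = c x ∨ w = c x + 1 ∨ w = c x + 3
  refine .of_cycleExtension (by omega) (nonempty_aut_cycleExtension (R := R)
    (S := fun _ _ => False) (by omega) (Equiv.addRight 1) (fun x w => ?_) (by simp)
    (fun w => ?_) (fun v w h => ?_) ⟨0, 0, fun v w hv => ?_⟩) (by simp)
  · simp only [R, Equiv.coe_addRight, map_add, map_one, add_left_inj]
    rw [add_right_comm _ 1 3, add_left_inj]
  · have hl : Nat.card ((cycleExtension R fun _ _ => False).neighborSet (.inl 0)) = 5 := by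
      have : (cycleExtension R fun _ _ => False).neighborSet (.inl 0) =
          ↑({.inl 1, .inl (-1), .inr 0, .inr 1, .inr 3} : Finset (ZMod n ⊕ ZMod m)) := by
        ext (x | w)
        · rw [SimpleGraph.mem_neighborSet, cycleExtension_adj_inl (by omega)]
          simp [eq_neg_iff_add_eq_zero, eq_comm]
        · simp [cycleExtension, R]
      rw [this, Nat.card_coe_set_eq, Set.ncard_coe_finset]
      rw [Finset.card_insert_of_notMem, Finset.card_insert_of_notMem,
        Finset.card_insert_of_notMem, Finset.card_insert_of_notMem, Finset.card_singleton]
      · simp only [Finset.mem_singleton, Sum.inr.injEq]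
        exact fun h => h2 (by linear_combination -h)
      · simp only [Finset.mem_insert, Finset.mem_singleton, Sum.inr.injEq]
        exact fun h => h.elim (fun h => h1 h.symm) (fun h => h3 h.symm)
      · simp
      · simp only [Finset.mem_insert, Finset.mem_singleton, Sum.inl.injEq, reduceCtorEq, or_false]
        exact fun h => hn2 (by linear_combination h)
    have hr : 3 ∣ Nat.card ((cycleExtension R fun _ _ => False).neighborSet (.inr w)) := by
      have hf : ∀ y, (Finset.univ.filter fun x => c x = y).card =
          (Finset.univ.filter fun x => c x = 0).card := fun y =>
        AddMonoidHom.card_fiber_eq_of_mem_range c.toAddMonoidHom (hcs y) (hcs 0)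
      have : (cycleExtension R fun _ _ => False).neighborSet (.inr w) =
          Sum.inl '' ↑((Finset.univ.filter fun x => c x = w) ∪
            ((Finset.univ.filter fun x => c x = w - 1) ∪
              (Finset.univ.filter fun x => c x = w - 3))) := by
        ext (x | v)
        · simp [cycleExtension, R, sub_eq_iff_eq_add, eq_comm (b := w), eq_comm (b := w - 1),
            eq_comm (b := w - 3)]
        · simp [cycleExtension]
      rw [this, Nat.card_coe_set_eq, Set.ncard_image_of_injective _ Sum.inl_injective,
        Set.ncard_coe_finset, Finset.card_union_of_disjoint, Finset.card_union_of_disjoint, hf w,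
        hf (w - 1), hf (w - 3)]
      · omega
      · refine Finset.disjoint_filter.2 fun x _ hx hx' => h2 ?_
        linear_combination hx' - hx
      · rw [← Finset.filter_or]
        refine Finset.disjoint_filter.2 fun x _ hx hx' => ?_
        rcases hx' with hx' | hx'
        · exact h1 (by linear_combination hx' - hx)
        · exact h3 (by linear_combination hx' - hx)
    omega
  · have key : ∀ y, (v = y ∨ v = y + 1 ∨ v = y + 3) ↔ (w = y ∨ w = y + 1 ∨ w = y + 3) := by
      intro y
      obtain ⟨x, rfl⟩ := hcs y
      exact h x
    have ha := (key (v - 1)).1 (.inr (.inl (by ring)))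
    rcases (key v).1 (.inl rfl) with rfl | rfl | rfl
    · rfl
    · rcases ha with h | h | h
      · exact absurd (by linear_combination h) h2
      · exact absurd (by linear_combination h) h1
      · exact absurd (by linear_combination -h) h1
    · rcases ha with h | h | h
      · exact absurd (by linear_combination h) h4
      · exact absurd (by linear_combination h) h3
      · exact absurd (by linear_combination h) h1
  · have key : ∀ y, (v = -y ∨ v = -y + 1 ∨ v = -y + 3) ↔ (0 = y ∨ 0 = y + 1 ∨ 0 = y + 3) := by
      intro y
      obtain ⟨x, rfl⟩ := hcs y
      rw [← map_neg]
      exact hv x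
    have ha := (key 0).2 (.inl rfl)
    have hb := (key (-1)).2 (.inr (.inl (by ring)))
    have hd := (key (-3)).2 (.inr (.inr (by ring)))
    exfalso
    rcases ha with rfl | rfl | rfl
    · rcases hb with h | h | h
      · exact h1 (by linear_combination -h)
      · exact h2 (by linear_combination -h)
      · exact h4 (by linear_combination -h)
    · rcases hd with h | h | h
      · exact h2 (by linear_combination -h)
      · exact h3 (by linear_combination -h)
      · exact h5 (by linear_combination -h)
    · rcases hb with h | h | h
      · exact h2 (by linear_combination h)
      · exact h1 (by linear_combination h)
      · exact h1 (by linear_combination -h)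

/-- The automorphism group of a graph, as a group of permutations. -/
def SimpleGraph.autEquivSubtype {V : Type*} (Γ : SimpleGraph V) :
    (Γ ≃g Γ) ≃ {σ : Equiv.Perm V // ∀ u v, Γ.Adj (σ u) (σ v) ↔ Γ.Adj u v} where
  toFun φ := ⟨φ.toEquiv, fun _ _ => φ.map_adj_iff⟩
  invFun σ := ⟨σ.1, σ.2 _ _⟩

theorem HasGraph.cyc_two : HasGraph (Cyc 2) 2 := by
  have : Fact (Nat.Prime 2) := ⟨Nat.prime_two⟩
  refine ⟨⊥, ⟨mulEquivOfPrimeCardEq (p := 2) ?_ (by simp)⟩⟩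
  rw [Nat.card_congr (SimpleGraph.autEquivSubtype _), Nat.card_eq_fintype_card]
  decide

theorem IsKleinFour.of_sq_eq_one {G : Type*} [Group G] (hc : Nat.card G = 4)
    (h : ∀ g : G, g ^ 2 = 1) : IsKleinFour G where
  card_four := hc
  exponent_two := by
    have := Nat.finite_of_card_ne_zero (hc.trans_ne four_ne_zero)
    have : Nontrivial G := Finite.one_lt_card_iff_nontrivial.1 (by omega)
    have : Fact (Nat.Prime 2) := ⟨Nat.prime_two⟩
    exact (Monoid.exponent_eq_prime_iff Nat.prime_two).2 fun g hg => orderOf_eq_prime (h g) hg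

theorem HasGraph.cyc_two_prod_cyc_two : HasGraph (Cyc 2 × Cyc 2) 4 := by
  let r : Fin 4 → Fin 4 → Bool := fun u v => u ≠ v ∧ u.val + v.val ≠ 1
  let Γ : SimpleGraph (Fin 4) := ⟨fun u v => r u v, ⟨by decide⟩, ⟨by decide⟩⟩
  let : DecidableRel Γ.Adj := fun u v => inferInstanceAs (Decidable (r u v = true))
  have hs : ∀ σ : Equiv.Perm (Fin 4), (∀ u v, Γ.Adj (σ u) (σ v) ↔ Γ.Adj u v) →
      ∀ v, σ (σ v) = v := by decide
  have hΓ : IsKleinFour (Γ ≃g Γ) := by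
    refine .of_sq_eq_one ?_ fun φ => ?_
    · rw [Nat.card_congr (SimpleGraph.autEquivSubtype _), Nat.card_eq_fintype_card]
      decide
    · ext v
      rw [sq]
      exact congrArg Fin.val (hs φ.toEquiv (fun _ _ => φ.map_adj_iff) v)
  have : IsKleinFour (Cyc 2 × Cyc 2) := .of_sq_eq_one (by simp) (by decide)
  exact ⟨Γ, IsKleinFour.nonempty_mulEquiv⟩

theorem HasGraph.cyc_of_not_prime {q : ℕ} (hq : IsPrimePow q) (h7 : 7 ≤ q) (hp : ¬ q.Prime) :
    HasGraph (Cyc q) (2 * q - 2) := by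
  obtain ⟨p, k, hpp, hk, rfl⟩ := (isPrimePow_nat_iff q).1 hq
  have hk2 : 2 ≤ k := by
    by_contra h
    obtain rfl : k = 1 := by omega
    exact hp (by simpa using hpp)
  have hpow : ∀ {a b : ℕ}, a ≤ b → p ^ a ≤ p ^ b := fun h => Nat.pow_le_pow_right hpp.pos h
  have hdvd : ∀ {m : ℕ}, m ∣ p ^ k → 7 ≤ m → m + 2 ≤ p ^ k →
      HasGraph (Cyc (p ^ k)) (2 * p ^ k - 2) :=
    fun {m} hm h7 h => (cyc_of_dvd h7 hm (pow_pos hpp.pos k).ne').mono (by omega) (by omega)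
  by_cases hp7 : 7 ≤ p
  · have := hpow hk2
    exact hdvd (dvd_pow_self p (by omega)) hp7 (by nlinarith)
  · have : p = 2 ∨ p = 3 ∨ p = 5 := by
      have := hpp.two_le
      interval_cases p <;> revert hpp <;> decide
    rcases this with rfl | rfl | rfl
    · have hk3 : 3 ≤ k := by
        by_contra h
        obtain rfl : k = 2 := by omega
        omega
      rcases hk3.eq_or_lt with rfl | hk4
      · exact cyc_eight
      · have := hpow (a := 4) hk4
        exact hdvd (pow_dvd_pow 2 hk3) (by norm_num) (by omega)
    · rcases hk2.eq_or_lt with rfl | hk3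
      · exact cyc_nine.mono (by norm_num) (by norm_num)
      · have := hpow (a := 3) hk3
        exact hdvd (pow_dvd_pow 3 hk2) (by norm_num) (by omega)
    · rcases hk2.eq_or_lt with rfl | hk3
      · exact cyc_twentyFive.mono (by norm_num) (by norm_num)
      · have := hpow (a := 3) hk3
        exact hdvd (pow_dvd_pow 5 hk2) (by norm_num) (by omega)

theorem HasGraph.cyc_of_seven_le {q : ℕ} (hq : IsPrimePow q) (h7 : 7 ≤ q) :
    HasGraph (Cyc q) (2 * q) := by
  by_cases hp : q.Prime
  · exact two_mul q ▸ cyc_of_dvd h7 dvd_rfl (by omega)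
  · exact (cyc_of_not_prime hq h7 hp).mono (by omega) (by omega)

theorem IsPrimePow.eq_of_lt_seven {q : ℕ} (hq : IsPrimePow q) (h : ¬ 7 ≤ q) :
    q = 2 ∨ q = 3 ∨ q = 4 ∨ q = 5 := by
  have := hq.two_le
  have h6 : q ≠ 6 := by
    rintro rfl
    exact absurd hq (by
      rw [isPrimePow_nat_iff_bounded]
      decide)
  omega

theorem HasGraph.cyc_of_three_le {q : ℕ} (hq : IsPrimePow q) (h3 : 3 ≤ q) :
    HasGraph (Cyc q) (3 * q) := by
  by_cases h7 : 7 ≤ q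
  · exact (cyc_of_seven_le hq h7).mono (by omega) (by omega)
  · rcases hq.eq_of_lt_seven h7 with rfl | rfl | rfl | rfl
    · omega
    · exact cyc_three
    · exact cyc_four.mono (by norm_num) (by norm_num)
    · exact cyc_five

theorem HasGraph.prod_of_lt {G H : Type*} [Group G] [Group H] {M N K : ℕ} (hG : HasGraph G M)
    (hH : HasGraph H N) (hM : 2 ≤ M) (hN : 2 ≤ N) (h : M + N < K) : HasGraph (G × H) K := by
  rcases eq_or_ne M N with rfl | hne
  · exact (hG.prod (hH.succ hN) (by omega) (by omega) (by omega)).mono (by omega) (by omega)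
  · exact (hG.prod hH (by omega) (by omega) hne).mono (by omega) (by omega)

/-- The pairs `(a, b)` for which the group `C_a × C_b` is exceptional. -/
def ExcPair (a b : ℕ) : Prop :=
  a = 2 ∧ b ≠ 2 ∧ b.Prime ∨ a = 2 ∧ b = 4 ∨ a = 3 ∧ b = 3 ∨ a = 3 ∧ b = 4 ∨ a = 3 ∧ b = 5 ∨
    a = 3 ∧ b = 7 ∨ a = 4 ∧ b = 4 ∨ a = 4 ∧ b = 5 ∨ a = 5 ∧ b = 5

theorem HasGraph.pair {a b : ℕ} (ha : IsPrimePow a) (hb : IsPrimePow b) (hab : a ≤ b)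
    (h : ¬ ExcPair a b) : HasGraph (Cyc a × Cyc b) (a * b) := by
  unfold ExcPair at h
  push Not at h
  obtain ⟨h1, h2, h3, h4, h5, h6, h7, h8, h9⟩ := h
  by_cases ha7 : 7 ≤ a
  · exact (cyc_of_seven_le ha ha7).prod_of_lt (cyc_of_seven_le hb (by omega)) (by omega)
      (by omega) (by nlinarith)
  rcases ha.eq_of_lt_seven ha7 with rfl | rfl | rfl | rfl
  · rcases eq_or_ne b 2 with rfl | hb2
    · exact cyc_two_prod_cyc_two
    by_cases hb7 : 7 ≤ b
    · exact (cyc_two.prod (cyc_of_not_prime hb hb7 (h1 rfl hb2)) (by omega) (by omega)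
        (by omega)).mono (by omega) (by omega)
    · rcases hb.eq_of_lt_seven hb7 with rfl | rfl | rfl | rfl
      · exact absurd rfl hb2
      · exact absurd Nat.prime_three (h1 rfl hb2)
      · exact absurd rfl (h2 rfl)
      · exact absurd Nat.prime_five (h1 rfl hb2)
  · have hb7 : 7 ≤ b := by
      by_contra hb7
      rcases hb.eq_of_lt_seven hb7 with rfl | rfl | rfl | rfl <;> simp_all
    have : b ≠ 7 := h6 rfl
    rcases eq_or_ne b 8 with rfl | hb8
    · exact cyc_three.prod_of_lt cyc_eight (by omega) (by omega) (by omega)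
    · exact (cyc_three.prod (cyc_of_seven_le hb hb7) (by omega) (by omega) (by omega)).mono
        (by omega) (by omega)
  · have hb7 : 7 ≤ b := by
      by_contra hb7
      rcases hb.eq_of_lt_seven hb7 with rfl | rfl | rfl | rfl <;> simp_all
    exact cyc_four.prod_of_lt (cyc_of_seven_le hb hb7) (by omega) (by omega) (by omega)
  · have hb7 : 7 ≤ b := by
      by_contra hb7
      rcases hb.eq_of_lt_seven hb7 with rfl | rfl | rfl | rfl <;> simp_all
    exact cyc_five.prod_of_lt (cyc_of_seven_le hb hb7) (by omega) (by omega) (by omega)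

theorem HasGraph.triple {a b c : ℕ} (ha : IsPrimePow a) (hb : IsPrimePow b) (hc : IsPrimePow c)
    (hab : a ≤ b) (hbc : b ≤ c) (h1 : ¬ (a = 2 ∧ b = 2 ∧ c = 3)) (h2 : ¬ (a = 2 ∧ b = 3 ∧ c = 3)) :
    HasGraph (Cyc a × Cyc b × Cyc c) (a * (b * c)) := by
  have ha2 := ha.two_le
  rcases ha2.eq_or_lt with rfl | ha3
  · rcases hab.eq_or_lt with rfl | hb3
    · refine .congr MulEquiv.prodAssoc ?_
      rcases hbc.eq_or_lt with rfl | hc3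
      · exact cyc_two_prod_cyc_two.prod_of_lt cyc_two (by omega) (by omega) (by omega)
      · exact (cyc_two_prod_cyc_two.prod (cyc_of_three_le hc hc3) (by omega) (by omega)
          (by omega)).mono (by omega) (by omega)
    · rcases eq_or_ne b 3 with rfl | hb3'
      · exact cyc_two.prod_of_lt (cyc_three.prod (cyc_of_three_le hc (by omega)) (by omega)
          (by omega) (by omega)) (by omega) (by omega) (by omega)
      · refine cyc_two.prod_of_lt ((cyc_of_three_le hb hb3).prod_of_lt (cyc_of_three_le hc
          (by omega)) (by omega) (by omega) (Nat.lt_succ_self _)) (by omega) (by omega) ?_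
        obtain ⟨y, rfl⟩ := Nat.exists_eq_add_of_le (show 4 ≤ b by omega)
        obtain ⟨z, rfl⟩ := Nat.exists_eq_add_of_le (show 4 ≤ c by omega)
        ring_nf
        nlinarith [Nat.zero_le (y * z)]
  · rcases eq_or_ne b 3 with rfl | hb3
    · obtain rfl : a = 3 := by omega
      refine .congr MulEquiv.prodAssoc ?_
      rcases hbc.eq_or_lt with rfl | hc3
      · exact cyc_three_prod_cyc_three.prod cyc_three (by omega) (by omega) (by omega)
      · exact cyc_three_prod_cyc_three.prod_of_lt (cyc_of_three_le hc (by omega)) (by omega)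
          (by omega) (by omega)
    · refine (cyc_of_three_le ha ha3).prod_of_lt ((cyc_of_three_le hb (by omega)).prod_of_lt
        (cyc_of_three_le hc (by omega)) (by omega) (by omega) (Nat.lt_succ_self _)) (by omega)
        (by omega) ?_
      obtain ⟨x, rfl⟩ := Nat.exists_eq_add_of_le (show 3 ≤ a from ha3)
      obtain ⟨y, rfl⟩ := Nat.exists_eq_add_of_le (show 4 ≤ b by omega)
      obtain ⟨z, rfl⟩ := Nat.exists_eq_add_of_le (show 4 ≤ c by omega)
      ring_nf
      nlinarith [Nat.zero_le (x * y * z), Nat.zero_le (x * y), Nat.zero_le (x * z),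
        Nat.zero_le (y * z)]

/-- The direct product of cyclic groups of the given orders. -/
def CycProd : List ℕ → Type
  | [] => Unit
  | q :: L => Cyc q × CycProd L

instance CycProd.instCommGroup : ∀ L, CommGroup (CycProd L)
  | [] => inferInstanceAs (CommGroup Unit)
  | q :: L =>
    have := instCommGroup L
    inferInstanceAs (CommGroup (Cyc q × CycProd L))

/-- Splitting off a factor. -/
def CycProd.consEquiv (q : ℕ) (L : List ℕ) : CycProd (q :: L) ≃* Cyc q × CycProd L :=
  MulEquiv.refl _

/-- The product of a single cyclic group. -/
def CycProd.singletonEquiv (q : ℕ) : CycProd [q] ≃* Cyc q :=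
  (CycProd.consEquiv q []).trans (MulEquiv.prodUnique (N := Unit))

theorem HasGraph.prod_cycProd {L : List ℕ} (hL : ∀ q ∈ L, IsPrimePow q) :
    ∀ {H : Type} [Group H] {h : ℕ}, 8 ≤ h → HasGraph H h →
      HasGraph (H × CycProd L) (h * L.prod) := by
  induction L with
  | nil =>
    intro H _ h _ hH
    exact (mul_one h).symm ▸ hH.congr (MulEquiv.prodUnique (N := Unit)).symm
  | cons q L ih =>
    intro H _ h h8 hH
    have hq := hL q (by simp)
    have hq2 := hq.two_le
    rw [List.prod_cons, ← mul_assoc]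
    refine .congr (MulEquiv.prodAssoc (P := CycProd L))
      (ih (fun r hr => hL r (by simp [hr])) (by nlinarith) ?_)
    rcases hq2.eq_or_lt with rfl | hq3
    · exact hH.prod_of_lt cyc_two (by omega) (by omega) (by omega)
    · exact hH.prod_of_lt (cyc_of_three_le hq hq3) (by omega) (by omega) (by nlinarith)

/-- The ordered lists of prime powers whose product group is exceptional. -/
def ExcList (L : List ℕ) : Prop :=
  (∃ q, q ≠ 2 ∧ L = [q]) ∨ (∃ a b, ExcPair a b ∧ L = [a, b]) ∨ L = [2, 2, 3] ∨ L = [2, 3, 3]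

theorem HasGraph.cycProd {L : List ℕ} (hL : ∀ q ∈ L, IsPrimePow q) (hs : L.Pairwise (· ≤ ·))
    (hE : ¬ ExcList L) : HasGraph (CycProd L) L.prod := by
  unfold ExcList at hE
  push Not at hE
  obtain ⟨h1, h2, h3, h4⟩ := hE
  match L with
  | [] => exact .of_subsingleton (G := Unit) le_rfl
  | [q] =>
    obtain rfl : q = 2 := by
      by_contra h
      exact h1 q h rfl
    exact cyc_two.congr (CycProd.singletonEquiv 2).symm
  | [a, b] =>
    have := pair (hL a (by simp)) (hL b (by simp)) (by simp_all) fun h => h2 a b h rfl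
    rw [show [a, b].prod = a * b by simp]
    exact this.congr ((MulEquiv.refl (Cyc a)).prodCongr (CycProd.singletonEquiv b).symm)
  | [a, b, c] =>
    have := triple (hL a (by simp)) (hL b (by simp)) (hL c (by simp)) (by simp_all) (by simp_all)
      (by simpa using h3) (by simpa using h4)
    rw [show [a, b, c].prod = a * (b * c) by simp]
    exact this.congr ((MulEquiv.refl (Cyc a)).prodCongr
      ((MulEquiv.refl (Cyc b)).prodCongr (CycProd.singletonEquiv c).symm))
  | a :: b :: c :: d :: L =>
    simp only [List.mem_cons, forall_eq_or_imp, List.pairwise_cons] at hL hs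
    obtain ⟨ha, hb, hc, hd, hL⟩ := hL
    obtain ⟨⟨hab, -⟩, ⟨hbc, -⟩, ⟨hcd, -⟩, -⟩ := hs
    by_cases hT : (a = 2 ∧ b = 2 ∧ c = 3) ∨ (a = 2 ∧ b = 3 ∧ c = 3)
    · have hQ : HasGraph (Cyc a × Cyc b × Cyc c × Cyc d) (a * (b * (c * d))) := by
        rcases hT with ⟨rfl, rfl, rfl⟩ | ⟨rfl, rfl, rfl⟩
        · exact .congr MulEquiv.prodAssoc
            (cyc_two_prod_cyc_two.prod_of_lt (cyc_three.prod_of_lt (cyc_of_three_le hd hcd)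
              (by omega) (by omega) (Nat.lt_succ_self _)) (by omega) (by omega) (by omega))
        · exact cyc_two.prod_of_lt (.congr MulEquiv.prodAssoc
            (cyc_three_prod_cyc_three.prod_of_lt (cyc_of_three_le hd hcd) (by omega) (by omega)
              (Nat.lt_succ_self _))) (by omega) (by omega) (by omega)
      have := hQ.prod_cycProd hL (by rcases hT with ⟨rfl, rfl, rfl⟩ | ⟨rfl, rfl, rfl⟩ <;> omega)
      rw [show (a :: b :: c :: d :: L).prod = a * (b * (c * d)) * L.prod by simp [mul_assoc]]
      exact this.congr (MulEquiv.prodAssoc.trans ((MulEquiv.refl (Cyc a)).prodCongr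
        (MulEquiv.prodAssoc.trans ((MulEquiv.refl (Cyc b)).prodCongr MulEquiv.prodAssoc))))
    · push Not at hT
      have hT := triple ha hb hc hab hbc (by tauto) (by tauto)
      have hL' : ∀ q ∈ d :: L, IsPrimePow q := by simpa using ⟨hd, hL⟩
      have := hT.prod_cycProd hL' (Nat.mul_le_mul ha.two_le (Nat.mul_le_mul hb.two_le hc.two_le))
      rw [show (a :: b :: c :: d :: L).prod = a * (b * c) * (d :: L).prod by simp [mul_assoc]]
      exact this.congr (MulEquiv.prodAssoc.trans ((MulEquiv.refl (Cyc a)).prodCongr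
        (MulEquiv.prodAssoc (P := CycProd (d :: L)))))

theorem CycProd.nonempty_equiv_of_perm {L L' : List ℕ} (h : L.Perm L') :
    Nonempty (CycProd L ≃* CycProd L') := by
  induction h with
  | nil => exact ⟨MulEquiv.refl _⟩
  | cons q _ ih => exact ih.map (MulEquiv.refl (Cyc q)).prodCongr
  | swap a b L =>
    exact ⟨(MulEquiv.prodAssoc (P := CycProd L)).symm.trans
      ((MulEquiv.prodComm.prodCongr (MulEquiv.refl (CycProd L))).trans MulEquiv.prodAssoc)⟩
  | trans _ _ ih₁ ih₂ =>
    obtain ⟨e⟩ := ih₁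
    obtain ⟨f⟩ := ih₂
    exact ⟨e.trans f⟩

theorem Cyc.card (n : ℕ) : Nat.card (Cyc n) = n := Nat.card_zmod n

theorem CycProd.card (L : List ℕ) : Nat.card (CycProd L) = L.prod := by
  induction L with
  | nil => exact Nat.card_unique (α := Unit)
  | cons q L ih =>
    rw [Nat.card_congr (CycProd.consEquiv q L).toEquiv, Nat.card_prod, ih, List.prod_cons,
      Cyc.card]

theorem CycProd.exists_equiv_pi {k : ℕ} (n : Fin k → ℕ) (hn : ∀ i, n i = 1 ∨ IsPrimePow (n i)) :
    ∃ L : List ℕ, (∀ q ∈ L, IsPrimePow q) ∧ Nonempty ((∀ i, Cyc (n i)) ≃* CycProd L) := by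
  induction k with
  | zero => exact ⟨[], by simp, ⟨MulEquiv.ofUnique (N := Unit)⟩⟩
  | succ k ih =>
    obtain ⟨L, hL, ⟨e⟩⟩ := ih (fun i => n i.succ) fun i => hn i.succ
    let f : (∀ i, Cyc (n i)) ≃* Cyc (n 0) × ∀ i : Fin k, Cyc (n i.succ) :=
      ⟨(Fin.consEquiv fun i => Cyc (n i)).symm, fun _ _ => rfl⟩
    rcases hn 0 with h0 | h0
    · have : Subsingleton (Cyc (n 0)) := by
        rw [h0]
        exact inferInstanceAs (Subsingleton (ZMod 1))
      have := Unique.mk' (Cyc (n 0))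
      exact ⟨L, hL, ⟨f.trans ((MulEquiv.uniqueProd).trans e)⟩⟩
    · exact ⟨n 0 :: L, by simpa using ⟨h0, hL⟩, ⟨f.trans ((MulEquiv.refl _).prodCongr e)⟩⟩

theorem CycProd.exists_equiv (G : Type*) [CommGroup G] [Finite G] :
    ∃ L : List ℕ, (∀ q ∈ L, IsPrimePow q) ∧ L.Pairwise (· ≤ ·) ∧ Nonempty (G ≃* CycProd L) := by
  obtain ⟨ι, _, p, hp, e, ⟨f⟩⟩ := AddCommGroup.equiv_directSum_zmod_of_finite (Additive G)
  let k := Fintype.equivFin ι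
  obtain ⟨L, hL, ⟨g⟩⟩ := CycProd.exists_equiv_pi (fun i => p (k.symm i) ^ e (k.symm i)) fun i => by
    rcases Nat.eq_zero_or_pos (e (k.symm i)) with h | h
    · exact .inl (by rw [h, pow_zero])
    · exact .inr ((hp _).isPrimePow.pow h.ne')
  have e₁ : G ≃* ∀ i, Cyc (p i ^ e i) := MulEquiv.toAdditive.symm <| f.trans <|
    (DirectSum.addEquivProd _).trans (MulEquiv.piMultiplicative _).toAdditiveRight
  have e₂ : (∀ i, Cyc (p i ^ e i)) ≃* ∀ i, Cyc (p (k.symm i) ^ e (k.symm i)) :=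
    ⟨Equiv.piCongrLeft' _ k, fun _ _ => rfl⟩
  obtain ⟨s⟩ := CycProd.nonempty_equiv_of_perm (L.perm_insertionSort (· ≤ ·)).symm
  exact ⟨L.insertionSort (· ≤ ·), by simpa using hL, L.pairwise_insertionSort _,
    ⟨e₁.trans (e₂.trans (g.trans s))⟩⟩

theorem HasGraph.exists_cycProd {L : List ℕ} (hL : ∀ q ∈ L, IsPrimePow q) :
    ∃ N, 0 < N ∧ HasGraph (CycProd L) N := by
  induction L with
  | nil => exact ⟨1, one_pos, .of_subsingleton (G := Unit) le_rfl⟩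
  | cons q L ih =>
    obtain ⟨N, hN, h⟩ := ih fun r hr => hL r (by simp [hr])
    have hq := hL q (by simp)
    obtain ⟨M, hM, hq⟩ : ∃ M, 2 ≤ M ∧ HasGraph (Cyc q) M := by
      rcases hq.two_le.eq_or_lt with rfl | h3
      · exact ⟨2, le_rfl, cyc_two⟩
      · exact ⟨3 * q, by omega, cyc_of_three_le hq h3⟩
    rcases eq_or_ne M N with rfl | hne
    · exact ⟨M + 1 + M, by omega, hq.succ hM |>.prod h (by omega) (by omega) (by omega)⟩
    · exact ⟨M + N, by omega, hq.prod h (by omega) (by omega) hne⟩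

/-- The Chinese remainder theorem, multiplicatively. -/
def Cyc.prodEquiv {a b : ℕ} (h : a.Coprime b) : Cyc a × Cyc b ≃* Cyc (a * b) :=
  (MulEquiv.prodMultiplicative _ _).symm.trans
    (ZMod.chineseRemainder h).symm.toAddEquiv.toMultiplicative

/-- A product of three cyclic groups as the multiplicative version of a product of three `ZMod`s. -/
def CycProd.tripleEquiv (a b c : ℕ) :
    CycProd [a, b, c] ≃* Multiplicative (ZMod a × ZMod b × ZMod c) :=
  ((MulEquiv.refl (Cyc a)).prodCongr
    (((MulEquiv.refl (Cyc b)).prodCongr (CycProd.singletonEquiv c)).trans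
      (MulEquiv.prodMultiplicative _ _).symm)).trans (MulEquiv.prodMultiplicative _ _).symm

theorem ExcList.exceptional {L : List ℕ} (hL : ∀ q ∈ L, IsPrimePow q) (hE : ExcList L)
    {G : Type*} [CommGroup G] (e : G ≃* CycProd L) : ExcCyclic G ∨ ExcTenAbelian G := by
  have hcyc : ∀ {n : ℕ}, (G ≃* Cyc n) → IsCyclic G ∧ Nat.card G = n := fun f =>
    ⟨isCyclic_of_surjective f.symm f.symm.surjective, (Nat.card_congr f.toEquiv).trans (Cyc.card _)⟩
  rcases hE with ⟨q, hq, rfl⟩ | ⟨a, b, hab, rfl⟩ | rfl | rfl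
  · obtain ⟨h, hc⟩ := hcyc (e.trans (CycProd.singletonEquiv q))
    obtain ⟨p, k, hp, hk, hpk⟩ := (isPrimePow_nat_iff q).1 (hL q (by simp))
    exact .inl ⟨h, by rwa [hc], .inl ⟨p, k, hp, hk, by rw [hc, hpk]⟩⟩
  · have f : G ≃* Cyc a × Cyc b :=
      e.trans ((MulEquiv.refl (Cyc a)).prodCongr (CycProd.singletonEquiv b))
    have hf : ∀ {n : ℕ}, a.Coprime b → a * b = n → Nonempty (G ≃* Cyc n) := fun h hn =>
      hn ▸ ⟨f.trans (Cyc.prodEquiv h)⟩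
    have hm : Nonempty (G ≃* Multiplicative (ZMod a × ZMod b)) :=
      ⟨f.trans (MulEquiv.prodMultiplicative _ _).symm⟩
    rcases hab with ⟨rfl, hb2, hb⟩ | ⟨rfl, rfl⟩ | ⟨rfl, rfl⟩ | ⟨rfl, rfl⟩ | ⟨rfl, rfl⟩ |
      ⟨rfl, rfl⟩ | ⟨rfl, rfl⟩ | ⟨rfl, rfl⟩ | ⟨rfl, rfl⟩
    · obtain ⟨g⟩ := hf ((Nat.coprime_primes Nat.prime_two hb).2 hb2.symm) rfl
      obtain ⟨h, hc⟩ := hcyc g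
      have := hb.two_le
      exact .inl ⟨h, by omega, .inr ⟨b, hb, hc⟩⟩
    · exact .inr (.inr <| .inr <| .inr <| .inr <| .inl hm)
    · exact .inr (.inr <| .inr <| .inr <| .inr <| .inr <| .inl hm)
    · exact .inr (.inl (hf (by decide) rfl))
    · exact .inr (.inr <| .inl (hf (by decide) rfl))
    · exact .inr (.inr <| .inr <| .inr <| .inl (hf (by decide) rfl))
    · exact .inr (.inr <| .inr <| .inr <| .inr <| .inr <| .inr <| .inl hm)
    · exact .inr (.inr <| .inr <| .inl (hf (by decide) rfl))
    · exact .inr (.inr <| .inr <| .inr <| .inr <| .inr <| .inr <| .inr <| .inl hm)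
  · exact .inr (.inr <| .inr <| .inr <| .inr <| .inr <| .inr <| .inr <| .inr <| .inl <| .intro <|
      e.trans <| CycProd.tripleEquiv 2 2 3)
  · exact .inr (.inr <| .inr <| .inr <| .inr <| .inr <| .inr <| .inr <| .inr <| .inr <| .intro <|
      e.trans <| CycProd.tripleEquiv 2 3 3)

/-- Proposition: for a finite abelian group `G`, either `α(G) ≤ |G|`, or `G`
is one of the specified exceptions, in which case `α(G) > |G|`. -/
theorem abelian_alpha_le_card_iff_not_exceptional (G : Type*) [CommGroup G] [Finite G] :
    (¬ ExcCyclic G ∧ ¬ ExcTenAbelian G → graphAlpha G ≤ Nat.card G) ∧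
    (ExcCyclic G ∨ ExcTenAbelian G → graphAlpha G > Nat.card G) := by
  obtain ⟨L, hL, hs, ⟨e⟩⟩ := CycProd.exists_equiv G
  constructor
  · intro h
    have hE : ¬ ExcList L := fun hE => not_or.2 h (hE.exceptional hL e)
    rw [Nat.card_congr e.toEquiv, CycProd.card]
    exact ((HasGraph.cycProd hL hs hE).congr e.symm).graphAlpha_le
  · intro h
    obtain ⟨N, -, hN⟩ := HasGraph.exists_cycProd hL
    obtain ⟨Γ, ⟨f⟩⟩ := Nat.sInf_mem (s := {n : ℕ | HasGraph G n}) ⟨N, hN.congr e.symm⟩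
    exact h.elim (fun h => h.card_lt f) fun h => h.card_lt f
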